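/- arXiv:0804.0034 — 3 statements merged into one kernel-verified Lean document; each statement's English description precedes it below -/
import Mathlib

section
/- Let n ≥ 3. There is a constant C = C(n) such that for every Schwartz function g on ℝ × ℝ^n, setting h(s,x) = ⟨x⟩^{-1} (⟨∂_s⟩^{1/4} g)(s,x), the Bochner integral ∫_ℝ e^{-isΔ} h(s,·) ds (which converges absolutely in L²(ℝ^n)) satisfies ‖ ∫_ℝ e^{-isΔ} h(s,·) ds ‖_{L²(ℝ^n)} ≤ C ‖g‖_{L²(ℝ×ℝ^n)}. -/
open MeasureTheory ENNReal SchwartzMap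

/-- The free Schrödinger evolution `(e^{itΔ}f)(x)`, given for `t ≠ 0` by the
explicit convolution formula with the principal branch of the complex power. -/
noncomputable def schrod (n : ℕ) (t : ℝ) (f : EuclideanSpace ℝ (Fin n) → ℂ)
    (x : EuclideanSpace ℝ (Fin n)) : ℂ :=
  if t = 0 then f x
  else (4 * Real.pi * Complex.I * (t : ℂ)) ^ (-(n : ℂ) / 2) *
    ∫ y : EuclideanSpace ℝ (Fin n),
      Complex.exp (Complex.I * (‖x - y‖ : ℂ) ^ 2 / (4 * (t : ℂ))) * f y

/-- The fractional derivative `⟨∂_s⟩^a` in the time variable, i.e. the Fourier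
multiplier with symbol `(1+λ²)^{a/2}`. -/
noncomputable def fracD {n : ℕ} (a : ℝ) (g : ℝ × EuclideanSpace ℝ (Fin n) → ℂ)
    (s : ℝ) (x : EuclideanSpace ℝ (Fin n)) : ℂ :=
  (2 * Real.pi : ℂ)⁻¹ *
    ∫ lam : ℝ, Complex.exp (Complex.I * (s : ℂ) * (lam : ℂ)) *
      (((1 + lam ^ 2 : ℝ) ^ (a / 2) : ℝ) : ℂ) *
      ∫ σ : ℝ, Complex.exp (-(Complex.I * (σ : ℂ) * (lam : ℂ))) * g (σ, x)

section Spacetime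

open Real FourierTransform
open scoped InnerProductSpace

variable {E : Type*} [NormedAddCommGroup E] [InnerProductSpace ℝ E] [FiniteDimensional ℝ E]
  [MeasurableSpace E] [BorelSpace E]

instance : (volume : Measure (ℝ × E)).HasTemperateGrowth :=
  inferInstanceAs (((volume : Measure ℝ).prod (volume : Measure E)).HasTemperateGrowth)

/-- The space-time Fourier transform on Schwartz functions. -/
noncomputable def spacetimeFourier (f : 𝓢(ℝ × E, ℂ)) : 𝓢(ℝ × E, ℂ) :=
  compCLMOfContinuousLinearEquiv ℂ (WithLp.prodContinuousLinearEquiv 2 ℝ ℝ E).symm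
    (𝓕 (compCLMOfContinuousLinearEquiv ℂ (WithLp.prodContinuousLinearEquiv 2 ℝ ℝ E) f))

/-- The inverse space-time Fourier transform on Schwartz functions. -/
noncomputable def spacetimeFourierInv (f : 𝓢(ℝ × E, ℂ)) : 𝓢(ℝ × E, ℂ) :=
  compCLMOfContinuousLinearEquiv ℂ (WithLp.prodContinuousLinearEquiv 2 ℝ ℝ E).symm
    (𝓕⁻ (compCLMOfContinuousLinearEquiv ℂ (WithLp.prodContinuousLinearEquiv 2 ℝ ℝ E) f))

theorem spacetimeFourier_spacetimeFourierInv (f : 𝓢(ℝ × E, ℂ)) :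
    spacetimeFourier (spacetimeFourierInv f) = f := by
  have : compCLMOfContinuousLinearEquiv ℂ (WithLp.prodContinuousLinearEquiv 2 ℝ ℝ E)
      (spacetimeFourierInv f) =
      𝓕⁻ (compCLMOfContinuousLinearEquiv ℂ (WithLp.prodContinuousLinearEquiv 2 ℝ ℝ E) f) := by
    ext x; simp [spacetimeFourierInv]
  rw [spacetimeFourier, this, FourierTransform.fourier_fourierInv_eq]
  ext x; simp

theorem spacetimeFourier_apply (f : 𝓢(ℝ × E, ℂ)) (l : ℝ) (ξ : E) :
    spacetimeFourier f (l, ξ) = ∫ p : ℝ × E, 𝐞 (-(p.1 * l + ⟪p.2, ξ⟫_ℝ)) • f p := by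
  simp only [spacetimeFourier, compCLMOfContinuousLinearEquiv_apply, Function.comp, fourier_coe,
    Real.fourier_eq]
  rw [← (WithLp.volume_preserving_toLp ℝ E).integral_comp
    (MeasurableEquiv.toLp 2 (ℝ × E)).measurableEmbedding]
  simp [WithLp.prod_inner_apply, mul_comm]

theorem spacetimeFourierInv_apply (f : 𝓢(ℝ × E, ℂ)) (l : ℝ) (ξ : E) :
    spacetimeFourierInv f (l, ξ) = ∫ p : ℝ × E, 𝐞 (p.1 * l + ⟪p.2, ξ⟫_ℝ) • f p := by
  simp only [spacetimeFourierInv, compCLMOfContinuousLinearEquiv_apply, Function.comp,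
    fourierInv_coe, Real.fourierInv_eq]
  rw [← (WithLp.volume_preserving_toLp ℝ E).integral_comp
    (MeasurableEquiv.toLp 2 (ℝ × E)).measurableEmbedding]
  simp [WithLp.prod_inner_apply, mul_comm]

theorem eLpNorm_fourier_eq {V : Type*} [NormedAddCommGroup V] [InnerProductSpace ℝ V]
    [FiniteDimensional ℝ V] [MeasurableSpace V] [BorelSpace V] (f : 𝓢(V, ℂ)) :
    eLpNorm (𝓕 f : 𝓢(V, ℂ)) 2 volume = eLpNorm f 2 volume := by
  have := norm_fourier_toL2_eq f
  rw [norm_toLp, norm_toLp] at this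
  exact (ENNReal.toReal_eq_toReal_iff' (SchwartzMap.eLpNorm_lt_top _ _ _).ne
    (SchwartzMap.eLpNorm_lt_top _ _ _).ne).1 this

theorem eLpNorm_fourierInv_eq {V : Type*} [NormedAddCommGroup V] [InnerProductSpace ℝ V]
    [FiniteDimensional ℝ V] [MeasurableSpace V] [BorelSpace V] (f : 𝓢(V, ℂ)) :
    eLpNorm (𝓕⁻ f : 𝓢(V, ℂ)) 2 volume = eLpNorm f 2 volume := by
  rw [← eLpNorm_fourier_eq, FourierTransform.fourier_fourierInv_eq]

theorem eLpNorm_spacetimeFourier (f : 𝓢(ℝ × E, ℂ)) :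
    eLpNorm (spacetimeFourier f) 2 volume = eLpNorm f 2 volume := by
  have h1 := eLpNorm_fourier_eq
    (compCLMOfContinuousLinearEquiv ℂ (WithLp.prodContinuousLinearEquiv 2 ℝ ℝ E) f)
  have h2 : eLpNorm (compCLMOfContinuousLinearEquiv ℂ (WithLp.prodContinuousLinearEquiv 2 ℝ ℝ E) f)
      2 volume = eLpNorm f 2 volume :=
    eLpNorm_comp_measurePreserving f.continuous.aestronglyMeasurable
      (WithLp.volume_preserving_ofLp ℝ E)
  rw [← h2, ← h1]
  rw [← eLpNorm_comp_measurePreserving (SchwartzMap.continuous _).aestronglyMeasurable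
      (WithLp.volume_preserving_toLp ℝ E)]
  rfl

/-- The restriction of a Schwartz function to a time slice. -/
noncomputable def timeSlice (s : ℝ) (f : 𝓢(ℝ × E, ℂ)) : 𝓢(E, ℂ) :=
  compCLM ℂ (g := fun y : E => (s, y))
    (by
      have h1 : (fun y : E => ((s, (0 : E)) : ℝ × E)).HasTemperateGrowth := .const _
      have h2 := (ContinuousLinearMap.inr ℝ ℝ E).hasTemperateGrowth
      convert h1.add h2 using 1
      ext y <;> simp)
    ⟨1, 1, fun x => by
      have := norm_snd_le ((s, x) : ℝ × E)
      simp only at this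
      linarith⟩ f

/-- The restriction of a Schwartz function to a vertical line. -/
noncomputable def spaceSlice (y : E) (f : 𝓢(ℝ × E, ℂ)) : 𝓢(ℝ, ℂ) :=
  compCLM ℂ (g := fun s : ℝ => (s, y))
    (by
      have h1 : (fun s : ℝ => (((0 : ℝ), y) : ℝ × E)).HasTemperateGrowth := .const _
      have h2 := (ContinuousLinearMap.inl ℝ ℝ E).hasTemperateGrowth
      convert h1.add h2 using 1
      ext y <;> simp)
    ⟨1, 1, fun x => by
      have := norm_fst_le ((x, y) : ℝ × E)
      simp only at this
      linarith⟩ f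

@[simp]
theorem timeSlice_apply (s : ℝ) (f : 𝓢(ℝ × E, ℂ)) (y : E) : timeSlice s f y = f (s, y) := rfl

@[simp]
theorem spaceSlice_apply (s : ℝ) (f : 𝓢(ℝ × E, ℂ)) (y : E) : spaceSlice y f s = f (s, y) := rfl

theorem integrable_fourierChar_smul {X : Type*} [MeasurableSpace X] [TopologicalSpace X]
    [OpensMeasurableSpace X] {μ : Measure X} {f : X → ℂ} (hf : Integrable f μ) {φ : X → ℝ}
    (hφ : Continuous φ) : Integrable (fun p => 𝐞 (φ p) • f p) μ := by
  refine hf.mono (AEStronglyMeasurable.smul ?_ hf.1) (.of_forall fun p => by simp [Circle.norm_smul])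
  exact (continuous_subtype_val.comp (Real.continuous_fourierChar.comp hφ)).aestronglyMeasurable

theorem integral_fourierChar_add_smul {X : Type*} [MeasurableSpace X] {μ : Measure X} (a : ℝ)
    (φ : X → ℝ) (f : X → ℂ) :
    ∫ x, 𝐞 (a + φ x) • f x ∂μ = 𝐞 a • ∫ x, 𝐞 (φ x) • f x ∂μ := by
  simp_rw [AddChar.map_add_eq_mul, mul_smul, Circle.smul_def, integral_smul]

theorem spacetimeFourier_eq_fourier_fourier_time (f : 𝓢(ℝ × E, ℂ)) (l : ℝ) (ξ : E) :
    spacetimeFourier f (l, ξ) = 𝓕 (fun y : E => 𝓕 (fun s : ℝ => f (s, y)) l) ξ := by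
  have : Integrable (fun p : ℝ × E => 𝐞 (-(p.1 * l + ⟪p.2, ξ⟫_ℝ)) • f p)
      ((volume : Measure ℝ).prod (volume : Measure E)) :=
    integrable_fourierChar_smul f.integrable (by fun_prop)
  rw [spacetimeFourier_apply, Measure.volume_eq_prod, integral_prod_symm _ this]
  simp only [Real.fourier_eq, ← integral_fourierChar_add_smul]
  congr! 6 with y t
  simp [mul_comm, add_comm]

theorem spacetimeFourier_eq_fourier_fourier_space (f : 𝓢(ℝ × E, ℂ)) (l : ℝ) (ξ : E) :
    spacetimeFourier f (l, ξ) = 𝓕 (fun s : ℝ => 𝓕 (fun y : E => f (s, y)) ξ) l := by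
  have : Integrable (fun p : ℝ × E => 𝐞 (-(p.1 * l + ⟪p.2, ξ⟫_ℝ)) • f p)
      ((volume : Measure ℝ).prod (volume : Measure E)) :=
    integrable_fourierChar_smul f.integrable (by fun_prop)
  rw [spacetimeFourier_apply, Measure.volume_eq_prod, integral_prod _ this]
  simp only [Real.fourier_eq, ← integral_fourierChar_add_smul]
  congr! 6 with s t
  simp [mul_comm, add_comm]

theorem spacetimeFourierInv_eq_time_space (f : 𝓢(ℝ × E, ℂ)) (l : ℝ) (ξ : E) :
    spacetimeFourierInv f (l, ξ) = 𝓕⁻ (fun s : ℝ => 𝓕⁻ (fun y : E => f (s, y)) ξ) l := by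
  have : Integrable (fun p : ℝ × E => 𝐞 (p.1 * l + ⟪p.2, ξ⟫_ℝ) • f p)
      ((volume : Measure ℝ).prod (volume : Measure E)) :=
    integrable_fourierChar_smul f.integrable (by fun_prop)
  rw [spacetimeFourierInv_apply, Measure.volume_eq_prod, integral_prod _ this]
  simp only [Real.fourierInv_eq, ← integral_fourierChar_add_smul]
  congr! 6 with s t
  simp [mul_comm]

theorem spacetimeFourierInv_eq_space_time (f : 𝓢(ℝ × E, ℂ)) (l : ℝ) (ξ : E) :
    spacetimeFourierInv f (l, ξ) = 𝓕⁻ (fun y : E => 𝓕⁻ (fun s : ℝ => f (s, y)) l) ξ := by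
  have : Integrable (fun p : ℝ × E => 𝐞 (p.1 * l + ⟪p.2, ξ⟫_ℝ) • f p)
      ((volume : Measure ℝ).prod (volume : Measure E)) :=
    integrable_fourierChar_smul f.integrable (by fun_prop)
  rw [spacetimeFourierInv_apply, Measure.volume_eq_prod, integral_prod_symm _ this]
  simp only [Real.fourierInv_eq, ← integral_fourierChar_add_smul]
  congr! 6 with y t
  simp [mul_comm, add_comm]

/-- A Schwartz function is dominated by an integrable function of any of its components. -/
theorem SchwartzMap.exists_integrable_bound_comp {D F : Type*} [NormedAddCommGroup D]
    [NormedSpace ℝ D] [NormedAddCommGroup F] [InnerProductSpace ℝ F] [FiniteDimensional ℝ F]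
    [MeasurableSpace F] [BorelSpace F] (f : 𝓢(D, ℂ)) (L : D →L[ℝ] F) :
    ∃ b : F → ℝ, Integrable b ∧ ∀ p, ‖f p‖ ≤ b (L p) := by
  set r : ℝ := Module.finrank ℝ F + 1
  have hm : (fun p : D => (1 + ‖L p‖ ^ 2) ^ (r / 2)).HasTemperateGrowth :=
    (Function.hasTemperateGrowth_one_add_norm_sq_rpow F (r / 2)).comp L.hasTemperateGrowth
  set g := smulLeftCLM ℂ (fun p : D => (1 + ‖L p‖ ^ 2) ^ (r / 2)) f
  obtain ⟨C, -, hC⟩ := g.decay 0 0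
  refine ⟨fun y => C * (1 + ‖y‖ ^ 2) ^ (-r / 2),
    (integrable_rpow_neg_one_add_norm_sq (by simp [r])).const_mul C, fun p => ?_⟩
  have h := hC p
  simp only [pow_zero, norm_iteratedFDeriv_zero, one_mul] at h
  rw [smulLeftCLM_apply_apply hm, norm_smul, Real.norm_of_nonneg (by positivity)] at h
  beta_reduce
  rw [neg_div, Real.rpow_neg (by positivity), ← div_eq_mul_inv, le_div_iff₀ (by positivity)]
  linarith

theorem continuous_fourier_time (f : 𝓢(ℝ × E, ℂ)) (l : ℝ) :
    Continuous fun y : E => 𝓕 (fun s : ℝ => f (s, y)) l := by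
  obtain ⟨b, hb, hbd⟩ := f.exists_integrable_bound_comp (ContinuousLinearMap.fst ℝ ℝ E)
  simp only [Real.fourier_eq]
  refine continuous_of_dominated (fun y => ?_) (fun y => .of_forall fun s => ?_) hb
    (.of_forall fun s => ?_)
  · exact (integrable_fourierChar_smul (spaceSlice y f).integrable (by fun_prop)).1
  · rw [Circle.norm_smul]; exact hbd (s, y)
  · have := f.continuous
    exact (this.comp (by fun_prop : Continuous fun y : E => (s, y))).const_smul _

theorem continuous_fourier_space (f : 𝓢(ℝ × E, ℂ)) (ξ : E) :
    Continuous fun s : ℝ => 𝓕 (fun y : E => f (s, y)) ξ := by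
  obtain ⟨b, hb, hbd⟩ := f.exists_integrable_bound_comp (ContinuousLinearMap.snd ℝ ℝ E)
  simp only [Real.fourier_eq]
  refine continuous_of_dominated (fun s => ?_) (fun s => .of_forall fun y => ?_) hb
    (.of_forall fun y => ?_)
  · exact (integrable_fourierChar_smul (timeSlice s f).integrable (by fun_prop)).1
  · rw [Circle.norm_smul]; exact hbd (s, y)
  · have := f.continuous
    exact (this.comp (by fun_prop : Continuous fun s : ℝ => (s, y))).const_smul _

/-- Fourier inversion in the space variable. -/
theorem fourierInv_spacetimeFourier_space (f : 𝓢(ℝ × E, ℂ)) (l : ℝ) (x : E) :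
    𝓕⁻ (fun ξ : E => spacetimeFourier f (l, ξ)) x = 𝓕 (fun s : ℝ => f (s, x)) l := by
  have h : (fun ξ : E => spacetimeFourier f (l, ξ)) =
      𝓕 (fun y : E => 𝓕 (fun s : ℝ => f (s, y)) l) :=
    funext fun ξ => spacetimeFourier_eq_fourier_fourier_time f l ξ
  rw [h, Continuous.fourierInv_fourier_eq (continuous_fourier_time f l)]
  · simp only [Real.fourier_eq]
    have : Integrable (fun p : ℝ × E => 𝐞 (-⟪p.1, l⟫_ℝ) • f p)
        ((volume : Measure ℝ).prod (volume : Measure E)) :=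
      integrable_fourierChar_smul f.integrable (by fun_prop)
    exact this.integral_prod_right
  · rw [← h]
    exact (timeSlice l (spacetimeFourier f)).integrable

/-- Fourier inversion in the time variable. -/
theorem fourierInv_spacetimeFourier_time (f : 𝓢(ℝ × E, ℂ)) (s : ℝ) (ξ : E) :
    𝓕⁻ (fun l : ℝ => spacetimeFourier f (l, ξ)) s = 𝓕 (fun y : E => f (s, y)) ξ := by
  have h : (fun l : ℝ => spacetimeFourier f (l, ξ)) =
      𝓕 (fun s : ℝ => 𝓕 (fun y : E => f (s, y)) ξ) :=
    funext fun l => spacetimeFourier_eq_fourier_fourier_space f l ξ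
  rw [h, Continuous.fourierInv_fourier_eq (continuous_fourier_space f ξ)]
  · simp only [Real.fourier_eq]
    have : Integrable (fun p : ℝ × E => 𝐞 (-⟪p.2, ξ⟫_ℝ) • f p)
        ((volume : Measure ℝ).prod (volume : Measure E)) :=
      integrable_fourierChar_smul f.integrable (by fun_prop)
    exact this.integral_prod_left
  · rw [← h]
    exact (spaceSlice ξ (spacetimeFourier f)).integrable

/-- Space derivatives of the space-time Fourier transform. -/
theorem fderiv_spacetimeFourier (f : 𝓢(ℝ × E, ℂ)) (p : ℝ × E) (v : E) :
    fderiv ℝ (spacetimeFourier f) p (0, v) =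
      spacetimeFourier (-(2 * π * Complex.I) •
        smulLeftCLM ℂ (fun p : ℝ × E => ⟪p.2, v⟫_ℝ) f) p := by
  have hv : (fun p : ℝ × E => ⟪p.2, v⟫_ℝ).HasTemperateGrowth :=
    (((innerSL ℝ).flip v) ∘L (ContinuousLinearMap.snd ℝ ℝ E)).hasTemperateGrowth
  have hv' : (fun q : WithLp 2 (ℝ × E) => ⟪q, WithLp.toLp 2 ((0 : ℝ), v)⟫_ℝ).HasTemperateGrowth :=
    ((innerSL ℝ).flip _).hasTemperateGrowth
  rw [← lineDerivOp_apply_eq_fderiv]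
  simp only [spacetimeFourier]
  rw [lineDerivOp_compCLMOfContinuousLinearEquiv]
  change compCLMOfContinuousLinearEquiv ℂ _
    (LineDeriv.lineDerivOp (WithLp.toLp 2 ((0 : ℝ), v)) (𝓕 _)) p = _
  rw [lineDerivOp_fourier_eq]
  congr 3
  ext q
  rw [smul_apply, smulLeftCLM_apply_apply hv', compCLMOfContinuousLinearEquiv_apply,
    compCLMOfContinuousLinearEquiv_apply, Function.comp, Function.comp, smul_apply,
    smulLeftCLM_apply_apply hv]
  simp [WithLp.prod_inner_apply]

end Spacetime

section Schrodinger

open Real FourierTransform Filter Topology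
open scoped InnerProductSpace

theorem integral_gaussian_mul_fourier {V : Type*} [NormedAddCommGroup V] [InnerProductSpace ℝ V]
    [FiniteDimensional ℝ V] [MeasurableSpace V] [BorelSpace V] {f : V → ℂ} (hf : Integrable f)
    {b : ℂ} (hb : 0 < b.re) (x : V) :
    ∫ w : V, Complex.exp (-b * ‖w‖ ^ 2 + 2 * π * Complex.I * ⟪x, w⟫_ℝ) * 𝓕 f w =
      (π / b) ^ (Module.finrank ℝ V / 2 : ℂ) *
        ∫ w : V, Complex.exp (-π ^ 2 * ‖x - w‖ ^ 2 / b) * f w := by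
  have J : Integrable (fun w : V => Complex.exp (-b * ‖w‖ ^ 2 + 2 * π * Complex.I * ⟪x, w⟫_ℝ)) :=
    GaussianFourier.integrable_cexp_neg_mul_sq_norm_add hb _ _
  have h := VectorFourier.integral_fourierIntegral_smul_eq_flip (L := innerₗ V)
      Real.continuous_fourierChar continuous_inner J hf
  have h' : ∫ w : V, 𝓕 (fun w => Complex.exp (-b * ‖w‖ ^ 2 + 2 * π * Complex.I * ⟪x, w⟫_ℝ)) w • f w
      = ∫ w : V, Complex.exp (-b * ‖w‖ ^ 2 + 2 * π * Complex.I * ⟪x, w⟫_ℝ) * 𝓕 f w := by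
    simpa using! h
  rw [← h', ← integral_const_mul]
  congr with w
  rw [fourier_gaussian_innerProductSpace' hb, smul_eq_mul, mul_assoc]

theorem norm_exp_neg_sq_div_le {b : ℂ} (hb : 0 ≤ b.re) (r : ℝ) :
    ‖Complex.exp (-π ^ 2 * r ^ 2 / b)‖ ≤ 1 := by
  rw [Complex.norm_exp, Real.exp_le_one_iff]
  have : (-π ^ 2 * r ^ 2 / b : ℂ) = ((-(π ^ 2 * r ^ 2) : ℝ) : ℂ) * b⁻¹ := by
    push_cast; ring
  rw [this, Complex.re_ofReal_mul, Complex.inv_re]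
  have : 0 ≤ b.re / Complex.normSq b := div_nonneg hb (Complex.normSq_nonneg b)
  nlinarith [mul_nonneg (by positivity : 0 ≤ π ^ 2 * r ^ 2) this]

/-- The Fourier representation of the free Schrödinger evolution. -/
theorem schrod_eq_fourierInv {n : ℕ} {t : ℝ} (ht : t ≠ 0) {f : EuclideanSpace ℝ (Fin n) → ℂ}
    (hf : Integrable f) (hf' : Integrable (𝓕 f)) (x : EuclideanSpace ℝ (Fin n)) :
    schrod n t f x =
      𝓕⁻ (fun w => 𝐞 (-(2 * π * t * ‖w‖ ^ 2)) • 𝓕 f w) x := by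
  set b : ℝ → ℂ := fun ε => ε + 4 * π ^ 2 * Complex.I * t with hbdef
  have hbre (ε : ℝ) : (b ε).re = ε := by simp [b, ← Complex.ofReal_pow]
  have hb0 : b 0 = 4 * π ^ 2 * Complex.I * t := by simp [b]
  have hbne : b 0 ≠ 0 := by
    rw [hb0]; simp [ht, Real.pi_ne_zero]
  have hbc : Continuous b := by fun_prop
  have hbt : Tendsto b (𝓝[>] 0) (𝓝 (b 0)) := (hbc.tendsto 0).mono_left nhdsWithin_le_nhds
  have hL : Tendsto (fun ε => ∫ w, Complex.exp (-(b ε) * ‖w‖ ^ 2 + 2 * π * Complex.I * ⟪x, w⟫_ℝ)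
      * 𝓕 f w) (𝓝[>] 0) (𝓝 (∫ w, Complex.exp (-(b 0) * ‖w‖ ^ 2 + 2 * π * Complex.I * ⟪x, w⟫_ℝ)
      * 𝓕 f w)) := by
    apply tendsto_integral_filter_of_dominated_convergence _ _ _ hf'.norm
    · refine .of_forall fun w => Tendsto.mul_const _ ?_
      exact ((by fun_prop : Continuous fun z : ℂ => Complex.exp (-z * ‖w‖ ^ 2 +
        2 * π * Complex.I * ⟪x, w⟫_ℝ)).tendsto _).comp hbt
    · exact .of_forall fun ε => (Continuous.aestronglyMeasurable (by fun_prop)).mul hf'.1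
    · filter_upwards [self_mem_nhdsWithin] with ε (hε : 0 < ε)
      refine .of_forall fun w => ?_
      rw [norm_mul]
      refine mul_le_of_le_one_left (norm_nonneg _) ?_
      rw [Complex.norm_exp, Real.exp_le_one_iff]
      have : (-(b ε) * ‖w‖ ^ 2 + 2 * π * Complex.I * ⟪x, w⟫_ℝ : ℂ).re = -(ε * ‖w‖ ^ 2) := by
        have : (-(b ε) * ‖w‖ ^ 2 + 2 * π * Complex.I * ⟪x, w⟫_ℝ : ℂ) =
          ((‖w‖ ^ 2 : ℝ) : ℂ) * (-(b ε)) + ((2 * π * ⟪x, w⟫_ℝ : ℝ) : ℂ) * Complex.I := by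
            push_cast; ring
        rw [this, Complex.add_re, Complex.re_ofReal_mul, Complex.re_ofReal_mul, Complex.neg_re,
          hbre]
        simp; ring
      rw [this]; simp; positivity
  have hR : Tendsto (fun ε => (π / b ε) ^ (n / 2 : ℂ) *
        ∫ w, Complex.exp (-π ^ 2 * ‖x - w‖ ^ 2 / b ε) * f w) (𝓝[>] 0)
      (𝓝 ((π / b 0) ^ (n / 2 : ℂ) * ∫ w, Complex.exp (-π ^ 2 * ‖x - w‖ ^ 2 / b 0) * f w)) := by
    refine Filter.Tendsto.mul ?_ ?_
    · refine (continuousAt_cpow_const ?_).tendsto.comp (tendsto_const_nhds.div hbt hbne)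
      rw [Complex.mem_slitPlane_iff]
      right
      have : (π / b 0 : ℂ) = ((-(1 / (4 * π * t)) : ℝ) : ℂ) * Complex.I := by
        rw [hb0]
        have := Complex.ofReal_ne_zero.2 Real.pi_ne_zero
        have := Complex.ofReal_ne_zero.2 ht
        push_cast
        field_simp
        simp
      rw [this]
      simp [ht, Real.pi_ne_zero]
    · apply tendsto_integral_filter_of_dominated_convergence _ _ _ hf.norm
      · refine .of_forall fun w => Tendsto.mul_const _ ?_
        exact (Complex.continuous_exp.tendsto _).comp (tendsto_const_nhds.div hbt hbne)
      · exact .of_forall fun ε => (Continuous.aestronglyMeasurable (by fun_prop)).mul hf.1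
      · filter_upwards [self_mem_nhdsWithin] with ε (hε : 0 < ε)
        refine .of_forall fun w => ?_
        rw [norm_mul]
        exact mul_le_of_le_one_left (norm_nonneg _)
          (norm_exp_neg_sq_div_le (by rw [hbre]; exact hε.le) _)
  have hLR := tendsto_nhds_unique (hL.congr' (by
    filter_upwards [self_mem_nhdsWithin] with ε (hε : 0 < ε)
    rw [integral_gaussian_mul_fourier hf (by rwa [hbre]), finrank_euclideanSpace_fin])) hR
  rw [Real.fourierInv_eq, schrod, if_neg ht]
  have h1 : (4 * π * Complex.I * t : ℂ) ^ (-(n : ℂ) / 2) = (π / b 0) ^ (n / 2 : ℂ) := by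
    have : (π / b 0 : ℂ) = (4 * π * Complex.I * t)⁻¹ := by
      rw [hb0]
      have := Complex.ofReal_ne_zero.2 Real.pi_ne_zero
      have := Complex.ofReal_ne_zero.2 ht
      field_simp
    rw [this, Complex.inv_cpow, neg_div, Complex.cpow_neg]
    intro h
    rw [Complex.arg_eq_pi_iff] at h
    have := h.1
    simp at this
  have h2 : ∀ y, Complex.exp (Complex.I * (‖x - y‖ : ℂ) ^ 2 / (4 * (t : ℂ))) =
      Complex.exp (-π ^ 2 * ‖x - y‖ ^ 2 / b 0) := fun y => by
    congr 1
    rw [hb0]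
    have := Complex.ofReal_ne_zero.2 Real.pi_ne_zero
    have := Complex.ofReal_ne_zero.2 ht
    have := Complex.I_ne_zero
    field_simp
    simp
  simp_rw [h1, h2]
  rw [← hLR]
  congr with w
  rw [smul_smul, ← AddChar.map_add_eq_mul, Circle.smul_def, Real.fourierChar_apply, smul_eq_mul,
    real_inner_comm, hb0]
  congr 2
  push_cast
  ring

end Schrodinger

section Representation

open Real FourierTransform
open scoped InnerProductSpace

variable {E : Type*} [NormedAddCommGroup E] [InnerProductSpace ℝ E] [FiniteDimensional ℝ E]
  [MeasurableSpace E] [BorelSpace E]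

theorem hasTemperateGrowth_timeSymbol (a : ℝ) :
    (fun p : ℝ × E => (1 + (2 * π * p.1) ^ 2) ^ a).HasTemperateGrowth := by
  have h1 := (Function.hasTemperateGrowth_one_add_norm_sq_rpow ℝ a).comp
    ((2 * π) • ContinuousLinearMap.fst ℝ ℝ E).hasTemperateGrowth
  have h2 : (fun p : ℝ × E => (1 + (2 * π * p.1) ^ 2) ^ a) =
      (fun x : ℝ => (1 + ‖x‖ ^ 2) ^ a) ∘ ⇑((2 * π) • ContinuousLinearMap.fst ℝ ℝ E) := by
    ext p
    simp [Function.comp, sq_abs, mul_pow]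
  rw [h2]
  exact h1

/-- Multiplication of a space-time Schwartz function by the Bessel symbol in time. -/
noncomputable def timeBessel (a : ℝ) (f : 𝓢(ℝ × E, ℂ)) : 𝓢(ℝ × E, ℂ) :=
  smulLeftCLM ℂ (fun p : ℝ × E => (1 + (2 * π * p.1) ^ 2) ^ a) f

theorem timeBessel_apply (a : ℝ) (f : 𝓢(ℝ × E, ℂ)) (p : ℝ × E) :
    timeBessel a f p = ((1 + (2 * π * p.1) ^ 2) ^ a : ℝ) * f p := by
  rw [timeBessel, smulLeftCLM_apply_apply (hasTemperateGrowth_timeSymbol a), Complex.real_smul]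

/-- Multiplication of a space-time Schwartz function by the inverse weight in space. -/
noncomputable def spaceWeight (f : 𝓢(ℝ × E, ℂ)) : 𝓢(ℝ × E, ℂ) :=
  smulLeftCLM ℂ (fun p : ℝ × E => (1 + ‖p.2‖ ^ 2) ^ (-(1 : ℝ) / 2)) f

theorem spaceWeight_apply (f : 𝓢(ℝ × E, ℂ)) (p : ℝ × E) :
    spaceWeight f p = ((1 + ‖p.2‖ ^ 2) ^ (-(1 : ℝ) / 2) : ℝ) * f p := by
  have h : (fun p : ℝ × E => (1 + ‖p.2‖ ^ 2) ^ (-(1 : ℝ) / 2)).HasTemperateGrowth :=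
    (Function.hasTemperateGrowth_one_add_norm_sq_rpow E (-(1 : ℝ) / 2)).comp
      (ContinuousLinearMap.snd ℝ ℝ E).hasTemperateGrowth
  rw [spaceWeight, smulLeftCLM_apply_apply h, Complex.real_smul]

theorem hasTemperateGrowth_paraboloidShear :
    (fun p : ℝ × E => (p.1 - 2 * π * ‖p.2‖ ^ 2, p.2)).HasTemperateGrowth := by
  have h1 : (fun p : ℝ × E => ‖p.2‖ ^ 2).HasTemperateGrowth :=
    (Function.hasTemperateGrowth_norm_sq E).comp
      (ContinuousLinearMap.snd ℝ ℝ E).hasTemperateGrowth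
  have h2 := ((2 * π) • ContinuousLinearMap.inl ℝ ℝ E).hasTemperateGrowth.comp h1
  have h3 := (ContinuousLinearMap.id ℝ (ℝ × E)).hasTemperateGrowth
  convert h3.sub h2 using 1
  ext p <;> simp

/-- Composition with the shear which maps the hyperplane of time frequency zero to the
characteristic paraboloid of the Schrödinger equation. -/
noncomputable def paraboloidShear (f : 𝓢(ℝ × E, ℂ)) : 𝓢(ℝ × E, ℂ) :=
  compCLM ℂ hasTemperateGrowth_paraboloidShear
    ⟨2, 1 + 2 * π, fun p => by
      set G := ‖(p.1 - 2 * π * ‖p.2‖ ^ 2, p.2)‖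
      have hG : 0 ≤ G := norm_nonneg _
      have h1 : |p.1 - 2 * π * ‖p.2‖ ^ 2| ≤ G := norm_fst_le (p.1 - 2 * π * ‖p.2‖ ^ 2, p.2)
      have h2 : ‖p.2‖ ≤ G := norm_snd_le (p.1 - 2 * π * ‖p.2‖ ^ 2, p.2)
      have hp := Real.pi_pos
      have h3 : ‖p.2‖ ^ 2 ≤ G ^ 2 := by gcongr
      have h4 : |p.1| ≤ G + 2 * π * G ^ 2 := by
        have := abs_add_le (p.1 - 2 * π * ‖p.2‖ ^ 2) (2 * π * ‖p.2‖ ^ 2)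
        rw [sub_add_cancel, abs_of_nonneg (by positivity : 0 ≤ 2 * π * ‖p.2‖ ^ 2)] at this
        nlinarith
      have h5 : G + 2 * π * G ^ 2 ≤ (1 + 2 * π) * (1 + G) ^ 2 := by
        nlinarith [mul_nonneg hp.le hG, sq_nonneg G]
      rw [Prod.norm_def]
      refine max_le (h4.trans h5) (h2.trans (le_trans ?_ h5))
      nlinarith [mul_nonneg hp.le (sq_nonneg G)]⟩ f

theorem paraboloidShear_apply (f : 𝓢(ℝ × E, ℂ)) (l : ℝ) (ξ : E) :
    paraboloidShear f (l, ξ) = f (l - 2 * π * ‖ξ‖ ^ 2, ξ) := rfl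

theorem fracD_eq_spacetimeFourierInv {n : ℕ} (a : ℝ) (f : 𝓢(ℝ × EuclideanSpace ℝ (Fin n), ℂ))
    (s : ℝ) (x : EuclideanSpace ℝ (Fin n)) :
    fracD a f s x = spacetimeFourierInv (timeBessel (a / 2) (spacetimeFourier f)) (s, x) := by
  rw [spacetimeFourierInv_eq_time_space]
  have h1 (l : ℝ) : 𝓕⁻ (fun ξ => timeBessel (a / 2) (spacetimeFourier f) (l, ξ)) x =
      ((1 + (2 * π * l) ^ 2) ^ (a / 2) : ℝ) * 𝓕 (fun s : ℝ => f (s, x)) l := by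
    rw [← fourierInv_spacetimeFourier_space, Real.fourierInv_eq, Real.fourierInv_eq,
      ← integral_const_mul]
    congr with ξ
    rw [timeBessel_apply, Circle.smul_def, Circle.smul_def, smul_eq_mul, smul_eq_mul]
    ring
  simp_rw [h1]
  rw [Real.fourierInv_eq, fracD]
  have h2 := Measure.integral_comp_mul_left (fun lam : ℝ =>
      Complex.exp (Complex.I * (s : ℂ) * (lam : ℂ)) *
      (((1 + lam ^ 2 : ℝ) ^ (a / 2) : ℝ) : ℂ) *
      ∫ σ : ℝ, Complex.exp (-(Complex.I * (σ : ℂ) * (lam : ℂ))) * f (σ, x)) (2 * π)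
  rw [abs_of_pos (by positivity)] at h2
  have h3 : ((2 * π)⁻¹ : ℂ) = (((2 * π)⁻¹ : ℝ) : ℂ) := by push_cast; rfl
  rw [h3, ← Complex.real_smul, ← h2]
  refine integral_congr_ae (.of_forall fun l => ?_)
  simp only
  rw [Circle.smul_def, Real.fourierChar_apply, smul_eq_mul, Real.fourier_eq, ← mul_assoc]
  congr 1
  · congr 2
    simp; ring
  · congr with σ
    rw [Circle.smul_def, Real.fourierChar_apply, smul_eq_mul]
    congr 2
    simp; ring

theorem schrod_spacetimeFourierInv {n : ℕ} (H : 𝓢(ℝ × EuclideanSpace ℝ (Fin n), ℂ)) {s : ℝ}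
    (hs : s ≠ 0) (x : EuclideanSpace ℝ (Fin n)) :
    schrod n (-s) (fun y => spacetimeFourierInv H (s, y)) x =
      spacetimeFourierInv (paraboloidShear H) (s, x) := by
  have e : (fun y => spacetimeFourierInv H (s, y)) = timeSlice s (spacetimeFourierInv H) := rfl
  rw [schrod_eq_fourierInv (neg_ne_zero.2 hs), spacetimeFourierInv_eq_space_time]
  · refine congrArg (fun F : EuclideanSpace ℝ (Fin n) → ℂ => (𝓕⁻ F : EuclideanSpace ℝ (Fin n) → ℂ) x)
      (funext fun w => ?_)
    rw [← fourierInv_spacetimeFourier_time, spacetimeFourier_spacetimeFourierInv,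
      Real.fourierInv_eq, Real.fourierInv_eq, ← integral_fourierChar_add_smul,
      ← integral_sub_right_eq_self _ (2 * π * ‖w‖ ^ 2)]
    congr with l
    rw [paraboloidShear_apply]
    congr 2
    simp
    ring
  · rw [e]
    exact (timeSlice s (spacetimeFourierInv H)).integrable
  · rw [e, ← fourier_coe]
    exact (𝓕 (timeSlice s (spacetimeFourierInv H))).integrable

theorem integral_spacetimeFourierInv (f : 𝓢(ℝ × E, ℂ)) (x : E) :
    ∫ s : ℝ, spacetimeFourierInv f (s, x) = 𝓕⁻ (timeSlice 0 f) x := by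
  have h := fourierInv_spacetimeFourier_space (spacetimeFourierInv f) 0 x
  rw [spacetimeFourier_spacetimeFourierInv] at h
  rw [fourierInv_coe]
  change _ = 𝓕⁻ (fun ξ => f (0, ξ)) x
  rw [h, Real.fourier_eq]
  simp

theorem integral_schrod_eq {n : ℕ} (a : ℝ) (g : 𝓢(ℝ × EuclideanSpace ℝ (Fin n), ℂ))
    (x : EuclideanSpace ℝ (Fin n)) :
    ∫ s : ℝ, schrod n (-s)
        (fun y => (((1 + ‖y‖ ^ 2 : ℝ) ^ (-(1 : ℝ) / 2) : ℝ) : ℂ) * fracD a (⇑g) s y) x =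
      𝓕⁻ (timeSlice 0 (paraboloidShear
        (timeBessel (a / 2) (spacetimeFourier (spaceWeight g))))) x := by
  rw [← integral_spacetimeFourierInv]
  refine integral_congr_ae ?_
  have h0 : ∀ᵐ s : ℝ, s ≠ 0 := by simp [ae_iff]
  filter_upwards [h0] with s hs
  rw [← schrod_spacetimeFourierInv _ hs]
  congr with y
  rw [← fracD_eq_spacetimeFourierInv, fracD, fracD, mul_left_comm, ← integral_const_mul]
  congr with l
  rw [mul_left_comm, ← integral_const_mul]
  congr with σ
  rw [spaceWeight_apply]
  ring

end Representation

section Trace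

open Real FourierTransform Filter Topology Set
open scoped InnerProductSpace

theorem ofReal_one_add_mul_norm_sq_le_lintegral {u u' : ℝ → ℂ} {w : ℝ → ℝ} {r : ℝ}
    (hr : 0 ≤ r) (hu : ∀ t, HasDerivAt u (u' t) t) (hw : Continuous w)
    (h : ∀ t, r ^ 2 * ‖u t‖ ^ 2 + ‖u' t‖ ^ 2 ≤ r ^ 2 * w t)
    (hlim : Tendsto (fun t => (√t + r) * ‖u t‖ ^ 2) atTop (𝓝 0)) :
    ENNReal.ofReal ((1 + r) * ‖u 1‖ ^ 2) ≤
      ∫⁻ t in Ioi 1, ENNReal.ofReal (3 * (r ^ 2 * (t * √t)) * w t) := by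
  set ψ : ℝ → ℝ := fun t => (√t + r) * ‖u t‖ ^ 2 with hψ
  set φ : ℝ → ℝ := fun t => 3 * (r ^ 2 * (t * √t)) * w t with hφ
  have huc : Continuous u := continuous_iff_continuousAt.2 fun t => (hu t).continuousAt
  have hφc : Continuous φ := by fun_prop
  have hψc : Continuous ψ := by fun_prop
  have hstep (T : ℝ) (hT : 1 ≤ T) :
      ENNReal.ofReal (ψ 1 - ψ T) ≤ ∫⁻ t in Ioi 1, ENNReal.ofReal (φ t) := by
    have h1 := intervalIntegral.sub_le_integral_of_hasDeriv_right_of_le (g := fun t => -ψ t)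
      (g' := fun t => -((1 / (2 * √t)) * ‖u t‖ ^ 2 + (√t + r) * (2 * ⟪u t, u' t⟫_ℝ))) (φ := φ)
      hT hψc.neg.continuousOn (fun t ht => by
        have ht0 : t ≠ 0 := by have := ht.1; positivity
        exact (((Real.hasDerivAt_sqrt ht0).add_const r).mul
          ((hu t).norm_sq)).neg.hasDerivWithinAt)
      (hφc.continuousOn.integrableOn_Icc) (fun t ht => by
        have ht1 : 1 < t := ht.1
        have ht0 : 0 < t := by linarith
        set s := √t
        have hs : s * s = t := Real.mul_self_sqrt ht0.le
        have hs1 : 1 < s := by rw [Real.lt_sqrt zero_le_one]; simpa using ht1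
        have hin : -⟪u t, u' t⟫_ℝ ≤ ‖u t‖ * ‖u' t‖ :=
          (neg_le_abs _).trans (abs_real_inner_le_norm _ _)
        have e1 := h t
        have hs0 : 0 < s := by linarith
        have a0 := norm_nonneg (u t)
        have b0 := norm_nonneg (u' t)
        generalize ‖u t‖ = a at *
        generalize ‖u' t‖ = b at *
        have k1 : 2 * s * (a * b) ≤ 1 / (2 * s) * a ^ 2 + 2 * (t * s) * b ^ 2 := by
          have : 1 / (2 * s) * a ^ 2 + 2 * (t * s) * b ^ 2 - 2 * s * (a * b) =
              1 / (2 * s) * (a - 2 * s ^ 2 * b) ^ 2 := by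
            rw [← hs]; field_simp; ring
          have : 0 ≤ 1 / (2 * s) * (a - 2 * s ^ 2 * b) ^ 2 := by positivity
          linarith
        have k2 : 2 * r * (a * b) ≤ r ^ 2 * w t := by nlinarith [sq_nonneg (r * a - b)]
        have k3 : b ^ 2 ≤ r ^ 2 * w t := by nlinarith [mul_nonneg (sq_nonneg r) (sq_nonneg a)]
        have k4 : (s + r) * (2 * -⟪u t, u' t⟫_ℝ) ≤ (s + r) * (2 * (a * b)) := by gcongr
        have k5 : 2 * (t * s) * b ^ 2 ≤ 2 * (t * s) * (r ^ 2 * w t) := by gcongr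
        have k6 : 1 ≤ t * s := by nlinarith
        have k7 : r ^ 2 * w t ≤ (t * s) * (r ^ 2 * w t) :=
          le_mul_of_one_le_left (le_trans (sq_nonneg b) k3) k6
        simp only [φ]
        nlinarith)
    rw [neg_sub_neg] at h1
    have h2 : ∀ t, 0 ≤ t → 0 ≤ φ t := fun t ht => by
      have : 0 ≤ r ^ 2 * w t := le_trans (by positivity) (h t)
      have : φ t = 3 * (t * √t) * (r ^ 2 * w t) := by simp only [φ]; ring
      rw [this]; positivity
    rw [intervalIntegral.integral_of_le hT] at h1
    refine (ENNReal.ofReal_le_ofReal h1).trans ?_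
    rw [ofReal_integral_eq_lintegral_ofReal]
    · exact lintegral_mono_set Ioc_subset_Ioi_self
    · exact (hφc.integrableOn_Icc).mono_set Ioc_subset_Icc_self
    · filter_upwards [ae_restrict_mem measurableSet_Ioc] with t ht
      exact h2 t (by have := ht.1; linarith)
  have hψ1 : (1 + r) * ‖u 1‖ ^ 2 = ψ 1 := by simp [ψ]
  have hl : Tendsto (fun T => ENNReal.ofReal (ψ 1 - ψ T)) atTop (𝓝 (ENNReal.ofReal (ψ 1))) := by
    have := (ENNReal.continuous_ofReal.tendsto _).comp (hlim.const_sub (ψ 1))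
    rwa [sub_zero] at this
  rw [hψ1]
  refine le_of_tendsto hl ?_
  filter_upwards [eventually_ge_atTop 1] with T hT using hstep T hT

variable {E : Type*} [NormedAddCommGroup E] [InnerProductSpace ℝ E] [FiniteDimensional ℝ E]
  [MeasurableSpace E] [BorelSpace E]

theorem lintegral_comp_smul {f : E → ℝ≥0∞} (hf : Measurable f) {t : ℝ} (ht : 0 < t) :
    ∫⁻ x, f (t • x) = ENNReal.ofReal (t ^ Module.finrank ℝ E)⁻¹ * ∫⁻ x, f x := by
  rw [← lintegral_map hf (measurable_const_smul t), Measure.map_addHaar_smul _ ht.ne',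
    lintegral_smul_measure, abs_of_nonneg (by positivity), smul_eq_mul]

theorem lintegral_comp_div_sq_le {a : ℝ} (ha : 0 ≤ a) (f : ℝ → ℝ≥0∞) :
    ∫⁻ t in Ioi 1, ENNReal.ofReal (a * (t ^ 3)⁻¹) * f (-(2 * π * a / t ^ 2)) ≤
      ENNReal.ofReal (4 * π)⁻¹ * ∫⁻ l, f l := by
  rcases ha.eq_or_lt with rfl | ha
  · simp
  have hpi := Real.pi_pos
  have h1 := lintegral_image_eq_lintegral_abs_deriv_mul (s := Ioi 1)
    (f := fun t : ℝ => -(2 * π * a / t ^ 2)) (f' := fun t => 4 * π * (a * (t ^ 3)⁻¹))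
    measurableSet_Ioi
    (fun t ht => by
      have ht0 : t ≠ 0 := by have : 1 < t := ht; positivity
      have := ((hasDerivAt_pow 2 t).inv (by positivity)).const_mul (2 * π * a) |>.neg
      refine HasDerivAt.hasDerivWithinAt ?_
      refine this.congr_deriv ?_
      push_cast
      field_simp
      norm_num)
    (fun x hx y hy hxy => by
      have hx0 : 0 < x := lt_trans one_pos hx
      have hy0 : 0 < y := lt_trans one_pos hy
      have h : 2 * π * a / x ^ 2 = 2 * π * a / y ^ 2 := neg_injective hxy
      rw [div_eq_div_iff (by positivity) (by positivity)] at h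
      have h' : y ^ 2 = x ^ 2 := mul_left_cancel₀ (by positivity) h
      exact ((pow_left_inj₀ hy0.le hx0.le two_ne_zero).1 h').symm) f
  have h2 : ∫⁻ t in Ioi 1, ENNReal.ofReal (a * (t ^ 3)⁻¹) * f (-(2 * π * a / t ^ 2)) =
      ENNReal.ofReal (4 * π)⁻¹ * ∫⁻ t in Ioi 1, ENNReal.ofReal |4 * π * (a * (t ^ 3)⁻¹)| *
        f (-(2 * π * a / t ^ 2)) := by
    rw [← lintegral_const_mul' _ _ ENNReal.ofReal_ne_top]
    refine setLIntegral_congr_fun measurableSet_Ioi fun t ht => ?_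
    have ht0 : 0 < t := lt_trans one_pos ht
    rw [← mul_assoc, ← ENNReal.ofReal_mul (by positivity), abs_of_nonneg (by positivity)]
    congr 2
    field_simp
  rw [h2, ← h1]
  gcongr
  exact Measure.restrict_le_self

theorem lintegral_lintegral_paraboloid_smul_le (hE : 3 ≤ Module.finrank ℝ E) {W : ℝ × E → ℝ≥0∞}
    (hW : Measurable W) :
    ∫⁻ ξ : E, ∫⁻ t in Ioi (1 : ℝ),
        ENNReal.ofReal (‖ξ‖ ^ 2 * (t * √t)) * W (-(2 * π * ‖ξ‖ ^ 2), t • ξ) ≤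
      ENNReal.ofReal (4 * π)⁻¹ * ∫⁻ p, W p := by
  calc
    _ = ∫⁻ t in Ioi (1 : ℝ), ∫⁻ ξ : E,
        ENNReal.ofReal (‖ξ‖ ^ 2 * (t * √t)) * W (-(2 * π * ‖ξ‖ ^ 2), t • ξ) := by
      refine lintegral_lintegral_swap (Measurable.aemeasurable ?_)
      refine Measurable.mul (by fun_prop) (hW.comp (by fun_prop))
    _ ≤ ∫⁻ t in Ioi (1 : ℝ), ∫⁻ η : E,
        ENNReal.ofReal (‖η‖ ^ 2 * (t ^ 3)⁻¹) * W (-(2 * π * ‖η‖ ^ 2 / t ^ 2), η) := by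
      refine setLIntegral_mono' measurableSet_Ioi fun t (ht : 1 < t) => ?_
      have ht0 : 0 < t := lt_trans one_pos ht
      have h1 := lintegral_comp_smul (E := E) (f := fun η =>
        ENNReal.ofReal (‖η‖ ^ 2 * (√t / t)) * W (-(2 * π * ‖η‖ ^ 2 / t ^ 2), η))
        (Measurable.mul (by fun_prop) (hW.comp (by fun_prop))) ht0
      have h2 : ∀ ξ : E, ENNReal.ofReal (‖t • ξ‖ ^ 2 * (√t / t)) *
          W (-(2 * π * ‖t • ξ‖ ^ 2 / t ^ 2), t • ξ) =
          ENNReal.ofReal (‖ξ‖ ^ 2 * (t * √t)) * W (-(2 * π * ‖ξ‖ ^ 2), t • ξ) := fun ξ => by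
        rw [norm_smul, Real.norm_of_nonneg ht0.le]
        have e1 : (t * ‖ξ‖) ^ 2 * (√t / t) = ‖ξ‖ ^ 2 * (t * √t) := by field_simp
        have e2 : 2 * π * (t * ‖ξ‖) ^ 2 / t ^ 2 = 2 * π * ‖ξ‖ ^ 2 := by field_simp
        rw [e1, e2]
      simp_rw [h2] at h1
      rw [h1, ← lintegral_const_mul' _ _ ENNReal.ofReal_ne_top]
      refine lintegral_mono fun η => ?_
      simp only
      rw [← mul_assoc, ← ENNReal.ofReal_mul (by positivity)]
      refine mul_le_mul_left (ENNReal.ofReal_le_ofReal ?_) _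
      rw [mul_left_comm]
      refine mul_le_mul_of_nonneg_left ?_ (by positivity)
      have h3 : √t / t ≤ 1 := by
        rw [div_le_one ht0, Real.sqrt_le_left ht0.le]
        nlinarith
      calc (t ^ Module.finrank ℝ E)⁻¹ * (√t / t) ≤ (t ^ Module.finrank ℝ E)⁻¹ * 1 := by gcongr
        _ ≤ (t ^ 3)⁻¹ := by
          rw [mul_one]
          gcongr
          exact ht.le
    _ = ∫⁻ η : E, ∫⁻ t in Ioi (1 : ℝ),
        ENNReal.ofReal (‖η‖ ^ 2 * (t ^ 3)⁻¹) * W (-(2 * π * ‖η‖ ^ 2 / t ^ 2), η) := by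
      refine lintegral_lintegral_swap (Measurable.aemeasurable ?_)
      refine Measurable.mul (by fun_prop) (hW.comp (by fun_prop))
    _ ≤ ∫⁻ η : E, ENNReal.ofReal (4 * π)⁻¹ * ∫⁻ l, W (l, η) :=
      lintegral_mono fun η => lintegral_comp_div_sq_le (by positivity) fun l => W (l, η)
    _ = _ := by
      rw [lintegral_const_mul' _ _ ENNReal.ofReal_ne_top, Measure.volume_eq_prod,
        lintegral_prod_symm' _ hW]

end Trace

section Estimate

open Real FourierTransform Filter Topology Set
open scoped InnerProductSpace

theorem eLpNorm_two_sq_eq_lintegral {X : Type*} [MeasurableSpace X] {μ : Measure X} (f : X → ℂ) :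
    eLpNorm f 2 μ ^ 2 = ∫⁻ x, ‖f x‖ₑ ^ 2 ∂μ := by
  have h := eLpNorm_nnreal_pow_eq_lintegral (μ := μ) (f := f) (p := 2) two_ne_zero
  simpa using h

theorem ofReal_norm_sq_eq (z : ℂ) : ENNReal.ofReal (‖z‖ ^ 2) = ‖z‖ₑ ^ 2 := by
  rw [ENNReal.ofReal_pow (norm_nonneg _), ofReal_norm]

variable {n : ℕ}

local notation "𝔼" => EuclideanSpace ℝ (Fin n)

theorem norm_sq_fderiv_space_le (f : ℝ × 𝔼 → ℂ) (p : ℝ × 𝔼) (v : 𝔼) :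
    ‖fderiv ℝ f p (0, v)‖ ^ 2 ≤
      ‖v‖ ^ 2 * ∑ i, ‖fderiv ℝ f p (0, EuclideanSpace.single i 1)‖ ^ 2 := by
  set L : 𝔼 →L[ℝ] ℂ := fderiv ℝ f p ∘L ContinuousLinearMap.inr ℝ ℝ 𝔼 with hL
  have h (w : 𝔼) : fderiv ℝ f p (0, w) = L w := by simp [L]
  simp_rw [h]
  have hv : L v = ∑ i, v i • L (EuclideanSpace.single i 1) := by
    conv_lhs => rw [← (EuclideanSpace.basisFun (Fin n) ℝ).sum_repr v]
    simp [map_sum]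
  have h1 : ‖L v‖ ≤ ∑ i, |v i| * ‖L (EuclideanSpace.single i 1)‖ := by
    rw [hv]
    refine (norm_sum_le _ _).trans_eq ?_
    simp
  calc ‖L v‖ ^ 2 ≤ (∑ i, |v i| * ‖L (EuclideanSpace.single i 1)‖) ^ 2 := by gcongr
    _ ≤ (∑ i, |v i| ^ 2) * ∑ i, ‖L (EuclideanSpace.single i 1)‖ ^ 2 :=
      Finset.sum_mul_sq_le_sq_mul_sq _ _ _
    _ = _ := by simp [EuclideanSpace.norm_sq_eq]

/-- The energy density controlling restrictions of `f` to paraboloids. -/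
noncomputable def energyDensity (f : 𝓢(ℝ × 𝔼, ℂ)) (p : ℝ × 𝔼) : ℝ :=
  ‖f p‖ ^ 2 + ∑ i, ‖fderiv ℝ f p (0, EuclideanSpace.single i 1)‖ ^ 2

theorem continuous_energyDensity (f : 𝓢(ℝ × 𝔼, ℂ)) : Continuous (energyDensity f) := by
  have h1 := f.continuous
  have h2 : Continuous (fderiv ℝ f) := (f.smooth 1).continuous_fderiv one_ne_zero
  unfold energyDensity
  fun_prop

theorem tendsto_sqrt_add_mul_norm_sq (f : 𝓢(ℝ × 𝔼, ℂ)) (l : ℝ) {ξ : 𝔼} (hξ : ξ ≠ 0) :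
    Tendsto (fun t : ℝ => (√t + ‖ξ‖) * ‖f (l, t • ξ)‖ ^ 2) atTop (𝓝 0) := by
  have hr : 0 < ‖ξ‖ := norm_pos_iff.2 hξ
  set M := SchwartzMap.seminorm ℝ 1 0 f
  have hM : 0 ≤ M := apply_nonneg _ _
  have h1 : Tendsto (fun t : ℝ => ((1 + ‖ξ‖) * (M / ‖ξ‖) ^ 2) * t⁻¹) atTop (𝓝 0) := by
    have := tendsto_inv_atTop_zero.const_mul ((1 + ‖ξ‖) * (M / ‖ξ‖) ^ 2)
    rwa [mul_zero] at this
  refine squeeze_zero' (.of_forall fun t => by positivity) ?_ h1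
  filter_upwards [eventually_ge_atTop 1] with t ht
  have ht0 : 0 < t := by linarith
  have h2 := norm_pow_mul_le_seminorm ℝ f 1 (l, t • ξ)
  have h3 : t * ‖ξ‖ ≤ ‖(l, t • ξ)‖ := by
    have := norm_snd_le (l, t • ξ)
    rwa [norm_smul, Real.norm_of_nonneg ht0.le] at this
  have h4 : ‖f (l, t • ξ)‖ ≤ M / (t * ‖ξ‖) := by
    rw [le_div_iff₀ (by positivity), mul_comm]
    rw [pow_one] at h2
    exact le_trans (by gcongr) h2
  have h5 : √t ≤ t := by
    rw [Real.sqrt_le_left ht0.le]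
    nlinarith
  calc (√t + ‖ξ‖) * ‖f (l, t • ξ)‖ ^ 2 ≤ (t + t * ‖ξ‖) * (M / (t * ‖ξ‖)) ^ 2 := by
        gcongr
        exact le_mul_of_one_le_left hr.le ht
    _ = _ := by field_simp

theorem ofReal_one_add_mul_norm_sq_le_energyDensity (f : 𝓢(ℝ × 𝔼, ℂ)) (l : ℝ) {ξ : 𝔼}
    (hξ : ξ ≠ 0) :
    ENNReal.ofReal ((1 + ‖ξ‖) * ‖f (l, ξ)‖ ^ 2) ≤
      ENNReal.ofReal 3 * ∫⁻ t in Ioi (1 : ℝ),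
        ENNReal.ofReal (‖ξ‖ ^ 2 * (t * √t)) * ENNReal.ofReal (energyDensity f (l, t • ξ)) := by
  have h1 := ofReal_one_add_mul_norm_sq_le_lintegral (u := fun t => f (l, t • ξ))
    (u' := fun t => fderiv ℝ f (l, t • ξ) (0, ξ)) (w := fun t => energyDensity f (l, t • ξ))
    (norm_nonneg ξ)
    (fun t => by
      have h2 : HasDerivAt (fun t : ℝ => (l, t • ξ)) ((0 : ℝ), ξ) t := by
        have := (hasDerivAt_id t).smul_const ξ
        rw [one_smul] at this
        exact (hasDerivAt_const t l).prodMk this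
      exact ((f.differentiableAt (x := (l, t • ξ))).hasFDerivAt).comp_hasDerivAt t h2)
    ((continuous_energyDensity f).comp (by fun_prop))
    (fun t => by
      have := norm_sq_fderiv_space_le f (l, t • ξ) ξ
      simp only [energyDensity, mul_add]
      gcongr)
    (tendsto_sqrt_add_mul_norm_sq f l hξ)
  simp only [one_smul] at h1
  refine h1.trans_eq ?_
  rw [← lintegral_const_mul' _ _ ENNReal.ofReal_ne_top]
  refine setLIntegral_congr_fun measurableSet_Ioi fun t ht => ?_
  have ht0 : 0 < t := lt_trans one_pos ht
  rw [← ENNReal.ofReal_mul (by positivity), ← ENNReal.ofReal_mul (by positivity)]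
  congr 1
  ring

/-- A weighted trace estimate on the characteristic paraboloid. -/
theorem lintegral_paraboloid_le (hn : 3 ≤ n) (f : 𝓢(ℝ × 𝔼, ℂ)) :
    ∫⁻ ξ : 𝔼, ENNReal.ofReal ((1 + ‖ξ‖) * ‖f (-(2 * π * ‖ξ‖ ^ 2), ξ)‖ ^ 2) ≤
      ENNReal.ofReal 3 * (ENNReal.ofReal (4 * π)⁻¹ *
        ∫⁻ p, ENNReal.ofReal (energyDensity f p)) := by
  have : Nontrivial 𝔼 := by
    apply Module.nontrivial_of_finrank_pos (R := ℝ)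
    rw [finrank_euclideanSpace_fin]
    omega
  have hne : ∀ᵐ ξ : 𝔼, ξ ≠ 0 := by simp [ae_iff]
  calc
    _ ≤ ∫⁻ ξ : 𝔼, ENNReal.ofReal 3 * ∫⁻ t in Ioi (1 : ℝ), ENNReal.ofReal (‖ξ‖ ^ 2 * (t * √t)) *
        ENNReal.ofReal (energyDensity f (-(2 * π * ‖ξ‖ ^ 2), t • ξ)) := by
      refine lintegral_mono_ae ?_
      filter_upwards [hne] with ξ hξ
      exact ofReal_one_add_mul_norm_sq_le_energyDensity f _ hξ
    _ ≤ _ := by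
      rw [lintegral_const_mul' _ _ ENNReal.ofReal_ne_top]
      gcongr
      exact lintegral_lintegral_paraboloid_smul_le (by rwa [finrank_euclideanSpace_fin])
        (W := fun p => ENNReal.ofReal (energyDensity f p))
        (continuous_energyDensity f).measurable.ennreal_ofReal

theorem norm_spaceWeight_le (g : 𝓢(ℝ × 𝔼, ℂ)) (p : ℝ × 𝔼) : ‖spaceWeight g p‖ ≤ ‖g p‖ := by
  rw [spaceWeight_apply, norm_mul, Complex.norm_real, Real.norm_of_nonneg (by positivity)]
  refine mul_le_of_le_one_left (norm_nonneg _) ?_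
  exact Real.rpow_le_one_of_one_le_of_nonpos (by nlinarith [sq_nonneg ‖p.2‖]) (by norm_num)

theorem norm_coord_mul_spaceWeight_le (g : 𝓢(ℝ × 𝔼, ℂ)) (p : ℝ × 𝔼) {v : 𝔼} (hv : ‖v‖ = 1) :
    |⟪p.2, v⟫_ℝ| * ‖spaceWeight g p‖ ≤ ‖g p‖ := by
  rw [spaceWeight_apply, norm_mul, Complex.norm_real, Real.norm_of_nonneg (by positivity),
    ← mul_assoc]
  refine mul_le_of_le_one_left (norm_nonneg _) ?_
  have h1 : |⟪p.2, v⟫_ℝ| ≤ √(1 + ‖p.2‖ ^ 2) := by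
    have := abs_real_inner_le_norm p.2 v
    rw [hv, mul_one] at this
    exact this.trans (Real.le_sqrt_of_sq_le (by linarith))
  have h2 : (1 + ‖p.2‖ ^ 2) ^ (-(1 : ℝ) / 2) = (√(1 + ‖p.2‖ ^ 2))⁻¹ := by
    rw [Real.sqrt_eq_rpow, ← Real.rpow_neg (by positivity)]
    norm_num
  rw [h2, ← div_eq_mul_inv]
  exact div_le_one_of_le₀ h1 (Real.sqrt_nonneg _)

theorem lintegral_energyDensity_le (g : 𝓢(ℝ × 𝔼, ℂ)) :
    ∫⁻ p, ENNReal.ofReal (energyDensity (spacetimeFourier (spaceWeight g)) p) ≤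
      (1 + n * ENNReal.ofReal (2 * π) ^ 2) * eLpNorm g 2 volume ^ 2 := by
  set K := spacetimeFourier (spaceWeight g) with hK
  have h0 : eLpNorm K 2 volume ≤ eLpNorm g 2 volume := by
    rw [hK, eLpNorm_spacetimeFourier]
    exact eLpNorm_mono (norm_spaceWeight_le g)
  have h1 (i : Fin n) : eLpNorm (fun p => fderiv ℝ K p (0, EuclideanSpace.single i 1)) 2 volume ≤
      ENNReal.ofReal (2 * π) * eLpNorm g 2 volume := by
    simp_rw [hK, fderiv_spacetimeFourier]
    rw [eLpNorm_spacetimeFourier]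
    refine eLpNorm_le_mul_eLpNorm_of_ae_le_mul (.of_forall fun p => ?_) 2
    have hv : (fun p : ℝ × 𝔼 => ⟪p.2, EuclideanSpace.single i (1 : ℝ)⟫_ℝ).HasTemperateGrowth :=
      (((innerSL ℝ).flip (EuclideanSpace.single i (1 : ℝ))) ∘L
        (ContinuousLinearMap.snd ℝ ℝ 𝔼)).hasTemperateGrowth
    rw [_root_.smul_apply, smulLeftCLM_apply_apply hv, norm_smul, norm_smul]
    have h2 : ‖-(2 * π * Complex.I : ℂ)‖ = 2 * π := by
      simp [abs_of_pos Real.pi_pos]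
    rw [h2, Real.norm_eq_abs]
    gcongr
    exact norm_coord_mul_spaceWeight_le g p (by simp)
  have hm : Continuous (fderiv ℝ K) := (K.smooth 1).continuous_fderiv one_ne_zero
  calc ∫⁻ p, ENNReal.ofReal (energyDensity K p)
      = ∫⁻ p, (‖K p‖ₑ ^ 2 + ∑ i, ‖fderiv ℝ K p (0, EuclideanSpace.single i 1)‖ₑ ^ 2) := by
        refine lintegral_congr fun p => ?_
        rw [energyDensity, ENNReal.ofReal_add (by positivity) (by positivity),
          ENNReal.ofReal_sum_of_nonneg (fun _ _ => by positivity)]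
        simp_rw [ofReal_norm_sq_eq]
    _ = eLpNorm K 2 volume ^ 2 +
        ∑ i, eLpNorm (fun p => fderiv ℝ K p (0, EuclideanSpace.single i 1)) 2 volume ^ 2 := by
        rw [lintegral_add_left (K.continuous.measurable.enorm.pow_const 2),
          lintegral_finsetSum _ (fun i _ => by
            have : Continuous fun p => fderiv ℝ K p (0, EuclideanSpace.single i 1) := by fun_prop
            exact this.measurable.enorm.pow_const 2)]
        simp_rw [eLpNorm_two_sq_eq_lintegral]
    _ ≤ eLpNorm g 2 volume ^ 2 +
        ∑ _i : Fin n, (ENNReal.ofReal (2 * π) * eLpNorm g 2 volume) ^ 2 := by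
        gcongr with i
        exact h1 i
    _ = _ := by
        simp only [Finset.sum_const, Finset.card_univ, Fintype.card_fin, nsmul_eq_mul]
        ring

theorem one_add_sq_rpow_quarter_le {r : ℝ} (hr : 0 ≤ r) :
    (1 + (4 * π ^ 2 * r ^ 2) ^ 2) ^ (1 / 4 : ℝ) ≤ 7 * (1 + r) := by
  have hpi := Real.pi_pos
  have h1 : 1 + (4 * π ^ 2 * r ^ 2) ^ 2 ≤ (1 + 2 * π * r) ^ (4 : ℝ) := by
    have : 0 ≤ 2 * π * r := by positivity
    norm_cast
    nlinarith [pow_nonneg this 2, pow_nonneg this 3]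
  calc (1 + (4 * π ^ 2 * r ^ 2) ^ 2) ^ (1 / 4 : ℝ)
      ≤ ((1 + 2 * π * r) ^ (4 : ℝ)) ^ (1 / 4 : ℝ) := by gcongr
    _ = 1 + 2 * π * r := by
      rw [← Real.rpow_mul (by positivity)]
      norm_num
    _ ≤ _ := by nlinarith [Real.pi_lt_d2]

theorem norm_sq_paraboloidShear_timeBessel_le (K : 𝓢(ℝ × 𝔼, ℂ)) (ξ : 𝔼) :
    ‖paraboloidShear (timeBessel (1 / 4 / 2) K) (0, ξ)‖ ^ 2 ≤
      7 * ((1 + ‖ξ‖) * ‖K (-(2 * π * ‖ξ‖ ^ 2), ξ)‖ ^ 2) := by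
  rw [paraboloidShear_apply, timeBessel_apply, zero_sub, norm_mul, mul_pow, Complex.norm_real,
    Real.norm_of_nonneg (by positivity), ← mul_assoc]
  gcongr
  refine le_trans (le_of_eq ?_) (one_add_sq_rpow_quarter_le (norm_nonneg ξ))
  rw [← Real.rpow_natCast, ← Real.rpow_mul (by positivity)]
  congr 1
  · ring
  · norm_num

end Estimate

/-- Dual smoothing estimate for the quarter-derivative term: with
`h(s,x) = ⟨x⟩⁻¹ (⟨∂_s⟩^{1/4} g)(s,x)`,
`‖∫_ℝ e^{-isΔ} h(s,·) ds‖_{L²(ℝⁿ)} ≤ C ‖g‖_{L²(ℝ×ℝⁿ)}`. -/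
theorem dual_smoothing_quarter_derivative (n : ℕ) (hn : 3 ≤ n) :
    ∃ C : ℝ≥0∞, C ≠ ⊤ ∧
      ∀ g : 𝓢(ℝ × EuclideanSpace ℝ (Fin n), ℂ),
        eLpNorm
            (fun x => ∫ s : ℝ,
              schrod n (-s)
                (fun y => (((1 + ‖y‖ ^ 2 : ℝ) ^ (-(1 : ℝ) / 2) : ℝ) : ℂ) *
                  fracD ((1 : ℝ) / 4) (⇑g) s y) x)
            2 volume
          ≤ C * eLpNorm (⇑g) 2 volume := by
  set A : ℝ≥0∞ := ENNReal.ofReal 7 * (ENNReal.ofReal 3 * (ENNReal.ofReal (4 * Real.pi)⁻¹ *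
    (1 + n * ENNReal.ofReal (2 * Real.pi) ^ 2))) with hA
  have hA' : A ≠ ⊤ := by finiteness
  refine ⟨A ^ (1 / 2 : ℝ), ENNReal.rpow_ne_top_of_nonneg (by norm_num) hA', fun g => ?_⟩
  simp_rw [integral_schrod_eq]
  rw [eLpNorm_fourierInv_eq]
  refine (ENNReal.pow_le_pow_left_iff two_ne_zero).1 ?_
  rw [mul_pow, ← ENNReal.rpow_natCast (A ^ (1 / 2 : ℝ)), ← ENNReal.rpow_mul,
    (by norm_num : (1 / 2 : ℝ) * (2 : ℕ) = 1), ENNReal.rpow_one, eLpNorm_two_sq_eq_lintegral]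
  set K := spacetimeFourier (spaceWeight g)
  calc
    _ ≤ ∫⁻ ξ, ENNReal.ofReal 7 *
        ENNReal.ofReal ((1 + ‖ξ‖) * ‖K (-(2 * Real.pi * ‖ξ‖ ^ 2), ξ)‖ ^ 2) := by
      refine lintegral_mono fun ξ => ?_
      simp only
      rw [← ofReal_norm_sq_eq, ← ENNReal.ofReal_mul (by norm_num), timeSlice_apply]
      exact ENNReal.ofReal_le_ofReal (norm_sq_paraboloidShear_timeBessel_le K ξ)
    _ ≤ ENNReal.ofReal 7 * (ENNReal.ofReal 3 * (ENNReal.ofReal (4 * Real.pi)⁻¹ *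
        ((1 + n * ENNReal.ofReal (2 * Real.pi) ^ 2) * eLpNorm g 2 volume ^ 2))) := by
      rw [lintegral_const_mul' _ _ ENNReal.ofReal_ne_top]
      gcongr
      refine (lintegral_paraboloid_le hn K).trans ?_
      gcongr
      exact lintegral_energyDensity_le g
    _ = _ := by rw [hA]; ring
end

section
/- Let n ≥ 3. Every measurable function K : ℝ × ℝ^n → ℂ satisfying the pointwise bounds |K(t,x)| ≤ |x|^{-n-1/2} (1 + t²|x|^{-4})^{-5/8} whenever 0 < |t| ≤ 1, and |K(t,x)| ≤ e^{-|t|} |x|^{-n+2} ⟨x⟩^{-5/2} whenever |t| > 1, belongs to L²_t L¹_x: that is, ∫_ℝ ( ∫_{ℝ^n} |K(t,x)| dx )² dt < ∞. Consequently convolution with such a kernel K maps L²(ℝ×ℝ^n) boundedly into L^∞_t L²_x. -/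
open MeasureTheory ENNReal SchwartzMap

/-- The radial profile dominating both regimes of the kernel is integrable. -/
lemma integrable_radial_profile {n : ℕ} (hn : 1 ≤ n) :
    Integrable (fun x : EuclideanSpace ℝ (Fin n) =>
      ‖x‖ ^ (-(n : ℝ) + 2) * (1 + ‖x‖ ^ 2) ^ (-(5 : ℝ) / 4)) := by
  have : Nonempty (Fin n) := ⟨⟨0, hn⟩⟩
  rw [integrable_fun_norm_addHaar volume
    (f := fun r : ℝ => r ^ (-(n : ℝ) + 2) * (1 + r ^ 2) ^ (-(5 : ℝ) / 4))]
  have hderiv : ∀ r ∈ Set.Ici (0 : ℝ), HasDerivAt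
      (fun r : ℝ => -2 * (1 + r ^ 2) ^ (-(1 : ℝ) / 4)) (r * (1 + r ^ 2) ^ (-(5 : ℝ) / 4)) r := by
    intro r _
    have h0 : HasDerivAt (fun r : ℝ => 1 + r ^ 2) (2 * r) r := by
      simpa using (hasDerivAt_pow 2 r).const_add 1
    have h1 := (h0.rpow_const (p := -(1 : ℝ) / 4) (Or.inl (by positivity))).const_mul (-2)
    refine h1.congr_deriv ?_
    rw [show -(1 : ℝ) / 4 - 1 = -5 / 4 by norm_num]
    ring
  have hlim : Filter.Tendsto (fun r : ℝ => -2 * (1 + r ^ 2) ^ (-(1 : ℝ) / 4))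
      Filter.atTop (nhds 0) := by
    have h0 : Filter.Tendsto (fun r : ℝ => 1 + r ^ 2) Filter.atTop Filter.atTop :=
      Filter.tendsto_atTop_add_const_left _ _ (Filter.tendsto_pow_atTop two_ne_zero)
    have h1 := (tendsto_rpow_neg_atTop (y := 1 / 4) (by norm_num)).comp h0
    simpa [Function.comp_def, neg_div] using h1.const_mul (-2)
  refine (integrableOn_Ioi_deriv_of_nonneg' hderiv (fun r hr => ?_) hlim).congr_fun
    (fun r hr => ?_) measurableSet_Ioi
  · have : 0 < r := hr
    positivity
  · have hr : 0 < r := hr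
    simp only [finrank_euclideanSpace, Fintype.card_fin, smul_eq_mul]
    rw [← mul_assoc, ← Real.rpow_natCast r (n - 1), ← Real.rpow_add hr, Nat.cast_sub hn,
      show ((n : ℝ) - (1 : ℕ)) + (-n + 2) = 1 by push_cast; ring, Real.rpow_one]

/-- Comparison of the short-time profile at unit scale with the radial profile. -/
lemma rpow_mul_one_add_rpow_neg_four_le {n : ℕ} {u : ℝ} (hu : 0 < u) :
    u ^ (-(n : ℝ) - 1 / 2) * (1 + u ^ (-(4 : ℝ))) ^ (-(5 : ℝ) / 8) ≤
      2 ^ ((5 : ℝ) / 8) * (u ^ (-(n : ℝ) + 2) * (1 + u ^ 2) ^ (-(5 : ℝ) / 4)) := by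
  have e1 : 1 + u ^ (-(4 : ℝ)) = u ^ (-(4 : ℝ)) * (1 + u ^ 4) := by
    rw [mul_add, ← Real.rpow_natCast u 4, ← Real.rpow_add hu]
    norm_num
    ring
  have e2 : (1 + u ^ 2) ^ (-(5 : ℝ) / 4) = ((1 + u ^ 2) ^ 2) ^ (-(5 : ℝ) / 8) := by
    rw [← Real.rpow_natCast (1 + u ^ 2) 2, ← Real.rpow_mul (by positivity)]
    norm_num
  have e3 : (1 + u ^ 4) ^ (-(5 : ℝ) / 8) ≤
      2 ^ ((5 : ℝ) / 8) * (1 + u ^ 2) ^ (-(5 : ℝ) / 4) := by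
    have h : (1 + u ^ 4 : ℝ) ^ (-(5 : ℝ) / 8) ≤ ((1 + u ^ 2) ^ 2 / 2) ^ (-(5 : ℝ) / 8) :=
      Real.rpow_le_rpow_of_nonpos (by positivity) (by nlinarith [sq_nonneg (u ^ 2 - 1)])
        (by norm_num)
    rw [Real.div_rpow (by positivity) (by norm_num), ← e2] at h
    refine h.trans_eq ?_
    rw [show (-(5 : ℝ) / 8) = -(5 / 8) by ring, Real.rpow_neg (by norm_num : (0 : ℝ) ≤ 2),
      div_inv_eq_mul, mul_comm]
  rw [e1, Real.mul_rpow (by positivity) (by positivity), ← Real.rpow_mul hu.le, ← mul_assoc,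
    ← Real.rpow_add hu]
  calc _ = u ^ (-(n : ℝ) + 2) * (1 + u ^ 4) ^ (-(5 : ℝ) / 8) := by congr 2; ring
    _ ≤ u ^ (-(n : ℝ) + 2) * (2 ^ ((5 : ℝ) / 8) * (1 + u ^ 2) ^ (-(5 : ℝ) / 4)) := by gcongr
    _ = _ := by ring

/-- The short-time size bound is a parabolic rescaling of its profile at time one. -/
lemma short_time_bound_le_rescaled {n : ℕ} {t r : ℝ} (ht : 0 < |t|) (hr : 0 < r) :
    r ^ (-(n : ℝ) - 1 / 2) * (1 + t ^ 2 * r ^ (-(4 : ℝ))) ^ (-(5 : ℝ) / 8) ≤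
      2 ^ ((5 : ℝ) / 8) * √|t| ^ (-(n : ℝ) - 1 / 2) *
        (((√|t|)⁻¹ * r) ^ (-(n : ℝ) + 2) *
          (1 + ((√|t|)⁻¹ * r) ^ 2) ^ (-(5 : ℝ) / 4)) := by
  have hR : 0 < √|t| := Real.sqrt_pos.2 ht
  have hu : 0 < (√|t|)⁻¹ * r := by positivity
  have hru : r = √|t| * ((√|t|)⁻¹ * r) := by field_simp
  have ht2 : t ^ 2 = √|t| ^ (4 : ℝ) := by
    rw [Real.sqrt_eq_rpow, ← Real.rpow_mul ht.le, ← sq_abs, ← Real.rpow_natCast]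
    norm_num
  generalize (√|t|)⁻¹ * r = u at *
  generalize √|t| = R at *
  subst hru
  have e : t ^ 2 * (R * u) ^ (-(4 : ℝ)) = u ^ (-(4 : ℝ)) := by
    rw [ht2, Real.mul_rpow hR.le hu.le, ← mul_assoc, ← Real.rpow_add hR]
    norm_num
  rw [e, Real.mul_rpow hR.le hu.le]
  calc _ = R ^ (-(n : ℝ) - 1 / 2) *
        (u ^ (-(n : ℝ) - 1 / 2) * (1 + u ^ (-(4 : ℝ))) ^ (-(5 : ℝ) / 8)) := by ring
    _ ≤ R ^ (-(n : ℝ) - 1 / 2) * _ :=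
        mul_le_mul_of_nonneg_left (rpow_mul_one_add_rpow_neg_four_le hu) (by positivity)
    _ = _ := by ring

/-- A time weight in `L²` dominating the `L¹` norms of the time slices of the kernel. -/
lemma integrable_sq_time_weight :
    Integrable (fun t : ℝ =>
      (|t| ^ (-(1 : ℝ) / 4) * Real.exp (-|t|) + Real.exp (-|t|)) ^ 2) := by
  have h := integrable_fun_norm_addHaar (volume : Measure ℝ)
    (f := fun r : ℝ => (r ^ (-(1 : ℝ) / 4) * Real.exp (-r) + Real.exp (-r)) ^ 2)
  simp only [Real.norm_eq_abs] at h
  rw [h]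
  have key : ∀ s : ℝ, -1 < s →
      IntegrableOn (fun r : ℝ => r ^ s * Real.exp (-2 * r ^ (1 : ℝ))) (Set.Ioi 0) := fun s hs =>
    integrableOn_rpow_mul_exp_neg_mul_rpow hs one_pos two_pos
  refine (((key (-1 / 2) (by norm_num)).add ((key (-1 / 4) (by norm_num)).const_mul 2)).add
    (key 0 (by norm_num))).congr_fun (fun r hr => ?_) measurableSet_Ioi
  have hr : 0 < r := hr
  have e1 : Real.exp (-2 * r) = Real.exp (-r) ^ 2 := by
    rw [← Real.exp_nat_mul]; norm_num
  have e2 : r ^ (-(1 : ℝ) / 2) = (r ^ (-(1 : ℝ) / 4)) ^ 2 := by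
    rw [← Real.rpow_mul_natCast hr.le]; norm_num
  simp only [Pi.add_apply, Real.rpow_one, Real.rpow_zero, e1, e2, Module.finrank_self,
    Nat.sub_self, pow_zero, one_smul]
  ring

/-- Each time slice of the kernel has `L¹` norm controlled by the time weight. -/
lemma exists_lintegral_slice_le {n : ℕ} (hn : 1 ≤ n)
    (K : ℝ × EuclideanSpace ℝ (Fin n) → ℂ)
    (h1 : ∀ (t : ℝ) (x : EuclideanSpace ℝ (Fin n)), x ≠ 0 → 0 < |t| → |t| ≤ 1 →
      ‖K (t, x)‖ ≤ ‖x‖ ^ (-(n : ℝ) - 1 / 2) *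
        (1 + t ^ 2 * ‖x‖ ^ (-(4 : ℝ))) ^ (-(5 : ℝ) / 8))
    (h2 : ∀ (t : ℝ) (x : EuclideanSpace ℝ (Fin n)), x ≠ 0 → 1 < |t| →
      ‖K (t, x)‖ ≤ Real.exp (-|t|) * ‖x‖ ^ (-(n : ℝ) + 2) *
        (1 + ‖x‖ ^ 2) ^ (-(5 : ℝ) / 4)) :
    ∃ M : ℝ, 0 < M ∧ ∀ t : ℝ, t ≠ 0 →
      ∫⁻ x : EuclideanSpace ℝ (Fin n), ‖K (t, x)‖ₑ ≤
        ENNReal.ofReal (M * (|t| ^ (-(1 : ℝ) / 4) * Real.exp (-|t|) + Real.exp (-|t|))) := by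
  have : Nonempty (Fin n) := ⟨⟨0, hn⟩⟩
  set Ψ : EuclideanSpace ℝ (Fin n) → ℝ := fun x =>
    ‖x‖ ^ (-(n : ℝ) + 2) * (1 + ‖x‖ ^ 2) ^ (-(5 : ℝ) / 4) with hΨ
  have hint : Integrable Ψ := integrable_radial_profile hn
  have hΨ0 : ∀ x, 0 ≤ Ψ x := fun x => by positivity
  have hI : 0 ≤ ∫ x, Ψ x := integral_nonneg hΨ0
  set I : ℝ := ∫ x, Ψ x with hIdef
  have slice : ∀ (t c R : ℝ), 0 ≤ c → 0 < R → (∀ x, x ≠ 0 → ‖K (t, x)‖ ≤ c * Ψ (R⁻¹ • x)) →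
      ∫⁻ x : EuclideanSpace ℝ (Fin n), ‖K (t, x)‖ₑ ≤ ENNReal.ofReal (c * (R ^ n * I)) := by
    intro t c R hc hR hb
    calc ∫⁻ x : EuclideanSpace ℝ (Fin n), ‖K (t, x)‖ₑ
        ≤ ∫⁻ x, ENNReal.ofReal (c * Ψ (R⁻¹ • x)) := by
          refine lintegral_mono_ae ?_
          filter_upwards [Measure.ae_ne volume (0 : EuclideanSpace ℝ (Fin n))] with x hx
          rw [← ofReal_norm]
          exact ENNReal.ofReal_le_ofReal (hb x hx)
      _ = ENNReal.ofReal (∫ x, c * Ψ (R⁻¹ • x)) :=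
          (ofReal_integral_eq_lintegral_ofReal
            ((hint.comp_smul (inv_ne_zero hR.ne')).const_mul c)
            (.of_forall fun x => mul_nonneg hc (hΨ0 _))).symm
      _ = ENNReal.ofReal (c * (R ^ n * I)) := by
          rw [integral_const_mul, Measure.integral_comp_inv_smul_of_nonneg _ _ hR.le]
          simp [hIdef]
  refine ⟨2 ^ ((5 : ℝ) / 8) * Real.exp 1 * (I + 1), by positivity, fun t ht => ?_⟩
  have ht0 : 0 < |t| := abs_pos.2 ht
  have hA : 1 ≤ (2 : ℝ) ^ ((5 : ℝ) / 8) := Real.one_le_rpow (by norm_num) (by norm_num)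
  have hE : 1 ≤ Real.exp 1 := Real.one_le_exp (by norm_num)
  rcases le_or_gt |t| 1 with h | h
  · have hR : 0 < √|t| := Real.sqrt_pos.2 ht0
    refine (slice t (2 ^ ((5 : ℝ) / 8) * √|t| ^ (-(n : ℝ) - 1 / 2)) (√|t|) (by positivity) hR
      fun x hx => (h1 t x hx ht0 h).trans ?_).trans (ENNReal.ofReal_le_ofReal ?_)
    · simpa only [hΨ, norm_smul, norm_inv, Real.norm_of_nonneg hR.le] using
        short_time_bound_le_rescaled (n := n) ht0 (norm_pos_iff.2 hx)
    · have e : √|t| ^ (-(n : ℝ) - 1 / 2) * √|t| ^ n = |t| ^ (-(1 : ℝ) / 4) := by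
        rw [← Real.rpow_natCast, ← Real.rpow_add hR, Real.sqrt_eq_rpow, ← Real.rpow_mul ht0.le]
        congr 1
        ring
      have hexp : 1 ≤ Real.exp 1 * Real.exp (-|t|) := by
        rw [← Real.exp_add]
        exact Real.one_le_exp (by linarith)
      calc _ = 2 ^ ((5 : ℝ) / 8) * |t| ^ (-(1 : ℝ) / 4) * I * 1 := by rw [← e]; ring
        _ ≤ 2 ^ ((5 : ℝ) / 8) * |t| ^ (-(1 : ℝ) / 4) * (I + 1) *
            (Real.exp 1 * Real.exp (-|t|)) := by gcongr; linarith
        _ = 2 ^ ((5 : ℝ) / 8) * Real.exp 1 * (I + 1) *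
            (|t| ^ (-(1 : ℝ) / 4) * Real.exp (-|t|)) := by ring
        _ ≤ _ := by gcongr; linarith [Real.exp_pos (-|t|)]
  · refine (slice t (Real.exp (-|t|)) 1 (by positivity) one_pos fun x hx => ?_).trans
      (ENNReal.ofReal_le_ofReal ?_)
    · simpa [hΨ, mul_assoc] using h2 t x hx h
    · calc _ = 1 * 1 * I * Real.exp (-|t|) := by simp; ring
        _ ≤ 2 ^ ((5 : ℝ) / 8) * Real.exp 1 * (I + 1) * Real.exp (-|t|) := by
            gcongr; linarith
        _ ≤ _ := by gcongr; linarith [show 0 ≤ |t| ^ (-(1 : ℝ) / 4) * Real.exp (-|t|) by positivity]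

/-- Cauchy–Schwarz with a weight depending on the kernel variable. -/
lemma sq_lintegral_mul_le_weighted {α : Type*} [MeasurableSpace α] (μ : Measure α)
    {k w f : α → ℝ≥0∞} (hk : Measurable k) (hw : Measurable w) (hf : Measurable f)
    (hw0 : ∀ a, w a ≠ 0) (hwt : ∀ a, w a ≠ ⊤) :
    (∫⁻ a, k a * f a ∂μ) ^ 2 ≤
      (∫⁻ a, w a * k a ∂μ) * ∫⁻ a, (w a)⁻¹ * k a * f a ^ 2 ∂μ := by
  have h := ENNReal.lintegral_mul_le_Lp_mul_Lq μ Real.HolderConjugate.two_two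
    (f := fun a => (w a * k a) ^ (1 / 2 : ℝ)) (g := fun a => ((w a)⁻¹ * k a) ^ (1 / 2 : ℝ) * f a)
    (by fun_prop) (by fun_prop)
  have e1 : ∀ a, ((fun a => (w a * k a) ^ (1 / 2 : ℝ)) *
      fun a => ((w a)⁻¹ * k a) ^ (1 / 2 : ℝ) * f a) a = k a * f a := fun a => by
    simp only [Pi.mul_apply]
    rw [← mul_assoc, ← ENNReal.mul_rpow_of_nonneg _ _ (by norm_num)]
    have : w a * k a * ((w a)⁻¹ * k a) = k a ^ (2 : ℝ) := by
      rw [ENNReal.rpow_two, sq, mul_mul_mul_comm, ENNReal.mul_inv_cancel (hw0 a) (hwt a), one_mul]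
    rw [this, ← ENNReal.rpow_mul]
    norm_num
  have e2 : ∀ b : ℝ≥0∞, (b ^ (1 / 2 : ℝ)) ^ 2 = b := fun b => by
    rw [← ENNReal.rpow_two, ← ENNReal.rpow_mul]
    norm_num
  simp only [e1, ENNReal.rpow_two, mul_pow, e2] at h
  calc _ ≤ _ := pow_le_pow_left' h 2
    _ = _ := by rw [mul_pow, e2, e2]

/-- Mixed-norm Young inequality `L²_t L¹_x * L²_{t,x} ⊆ L^∞_t L²_x`, in terms of a positive finite
weight dominating the spatial `L¹` norms of the kernel. -/
lemma lintegral_sq_convolution_slice_le {n : ℕ}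
    {k f : ℝ × EuclideanSpace ℝ (Fin n) → ℝ≥0∞} {w : ℝ → ℝ≥0∞}
    (hk : Measurable k) (hf : Measurable f) (hw : Measurable w)
    (hw0 : ∀ s, w s ≠ 0) (hwt : ∀ s, w s ≠ ⊤)
    (hkw : ∀ᵐ s, ∫⁻ x, k (s, x) ≤ w s) (t : ℝ) :
    ∫⁻ x, (∫⁻ p : ℝ × EuclideanSpace ℝ (Fin n), k (t - p.1, x - p.2) * f p) ^ 2 ≤
      (∫⁻ s, w s ^ 2) * ∫⁻ p, f p ^ 2 := by
  have : (volume : Measure (ℝ × EuclideanSpace ℝ (Fin n))).IsAddLeftInvariant := by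
    rw [Measure.volume_eq_prod]; infer_instance
  have : (volume : Measure (ℝ × EuclideanSpace ℝ (Fin n))).IsNegInvariant :=
    ⟨((Measure.measurePreserving_neg (volume : Measure ℝ)).prod
      (Measure.measurePreserving_neg (volume : Measure (EuclideanSpace ℝ (Fin n))))).map_eq⟩
  have hfirst : ∀ x : EuclideanSpace ℝ (Fin n),
      ∫⁻ p : ℝ × EuclideanSpace ℝ (Fin n), w (t - p.1) * k (t - p.1, x - p.2) ≤
        ∫⁻ s, w s ^ 2 := fun x => by
    calc _ = ∫⁻ p : ℝ × EuclideanSpace ℝ (Fin n), w p.1 * k p :=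
          lintegral_sub_left_eq_self (fun p : ℝ × EuclideanSpace ℝ (Fin n) => w p.1 * k p) (t, x)
      _ = ∫⁻ s, ∫⁻ y, w s * k (s, y) := by
          rw [Measure.volume_eq_prod, lintegral_prod _ (by fun_prop)]
      _ ≤ ∫⁻ s, w s ^ 2 := by
          refine lintegral_mono_ae ?_
          filter_upwards [hkw] with s hs
          rw [lintegral_const_mul _ (by fun_prop), sq]
          gcongr
  have hsecond : ∫⁻ x, ∫⁻ p : ℝ × EuclideanSpace ℝ (Fin n),
      (w (t - p.1))⁻¹ * k (t - p.1, x - p.2) * f p ^ 2 ≤ ∫⁻ p, f p ^ 2 := by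
    rw [lintegral_lintegral_swap (by fun_prop)]
    have hae : ∀ᵐ p : ℝ × EuclideanSpace ℝ (Fin n),
        ∫⁻ x, k (t - p.1, x) ≤ w (t - p.1) :=
      Measure.quasiMeasurePreserving_fst.ae
        ((quasiMeasurePreserving_sub_left_of_right_invariant volume t).ae hkw)
    refine lintegral_mono_ae ?_
    filter_upwards [hae] with p hp
    rw [lintegral_mul_const _ (by fun_prop), lintegral_const_mul _ (by fun_prop),
      lintegral_sub_right_eq_self (fun x => k (t - p.1, x)) p.2]
    calc _ ≤ (w (t - p.1))⁻¹ * w (t - p.1) * f p ^ 2 := by gcongr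
      _ = f p ^ 2 := by rw [ENNReal.inv_mul_cancel (hw0 _) (hwt _), one_mul]
  calc _ ≤ ∫⁻ x, (∫⁻ s, w s ^ 2) * ∫⁻ p : ℝ × EuclideanSpace ℝ (Fin n),
        (w (t - p.1))⁻¹ * k (t - p.1, x - p.2) * f p ^ 2 := by
        refine lintegral_mono fun x => ?_
        refine (sq_lintegral_mul_le_weighted volume
          (k := fun p : ℝ × EuclideanSpace ℝ (Fin n) => k (t - p.1, x - p.2))
          (w := fun p => w (t - p.1)) (by fun_prop) (by fun_prop) hf
          (fun _ => hw0 _) (fun _ => hwt _)).trans ?_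
        gcongr
        exact hfirst x
    _ = (∫⁻ s, w s ^ 2) * ∫⁻ x, ∫⁻ p : ℝ × EuclideanSpace ℝ (Fin n),
        (w (t - p.1))⁻¹ * k (t - p.1, x - p.2) * f p ^ 2 := by
        refine lintegral_const_mul _ (Measurable.lintegral_prod_right' (f := fun q :
          EuclideanSpace ℝ (Fin n) × (ℝ × EuclideanSpace ℝ (Fin n)) =>
          (w (t - q.2.1))⁻¹ * k (t - q.2.1, q.1 - q.2.2) * f q.2 ^ 2) (by fun_prop))
    _ ≤ _ := by gcongr

/-- Any kernel satisfying the size bounds of the commutator kernel `K₁`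
(i.e. `|K(t,x)| ≤ |x|^{-n-1/2}⟨t|x|^{-2}⟩^{-5/4}` for `0 < |t| ≤ 1` and
`|K(t,x)| ≤ e^{-|t|}|x|^{-n+2}⟨x⟩^{-5/2}` for `|t| > 1`) belongs to
`L²_t L¹_x`, and consequently convolution with it maps `L²(ℝ×ℝⁿ)` boundedly
into `L^∞_t L²_x`. -/
theorem commutator_kernel_K1_L2L1 (n : ℕ) (hn : 3 ≤ n)
    (K : ℝ × EuclideanSpace ℝ (Fin n) → ℂ) (hK : Measurable K)
    (h1 : ∀ (t : ℝ) (x : EuclideanSpace ℝ (Fin n)), x ≠ 0 → 0 < |t| → |t| ≤ 1 →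
      ‖K (t, x)‖ ≤ ‖x‖ ^ (-(n : ℝ) - 1 / 2) *
        (1 + t ^ 2 * ‖x‖ ^ (-(4 : ℝ))) ^ (-(5 : ℝ) / 8))
    (h2 : ∀ (t : ℝ) (x : EuclideanSpace ℝ (Fin n)), x ≠ 0 → 1 < |t| →
      ‖K (t, x)‖ ≤ Real.exp (-|t|) * ‖x‖ ^ (-(n : ℝ) + 2) *
        (1 + ‖x‖ ^ 2) ^ (-(5 : ℝ) / 4)) :
    (∫⁻ t : ℝ, (∫⁻ x : EuclideanSpace ℝ (Fin n), (‖K (t, x)‖₊ : ℝ≥0∞)) ^ 2) < ⊤ ∧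
    ∃ C : ℝ≥0∞, C ≠ ⊤ ∧
      ∀ g : 𝓢(ℝ × EuclideanSpace ℝ (Fin n), ℂ),
        essSup
            (fun t : ℝ => eLpNorm
              (fun x : EuclideanSpace ℝ (Fin n) =>
                ∫ p : ℝ × EuclideanSpace ℝ (Fin n), K (t - p.1, x - p.2) * g p)
              2 volume)
            volume
          ≤ C * eLpNorm (⇑g) 2 volume := by
  obtain ⟨M, hM, hslice⟩ := exists_lintegral_slice_le (by omega) K h1 h2
  set w : ℝ → ℝ≥0∞ := fun t =>
    ENNReal.ofReal (M * (|t| ^ (-(1 : ℝ) / 4) * Real.exp (-|t|) + Real.exp (-|t|))) with hwdef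
  have hw : Measurable w := by fun_prop
  have hw0 : ∀ s, w s ≠ 0 := fun s => (ENNReal.ofReal_pos.2 (by positivity)).ne'
  have hwt : ∀ s, w s ≠ ⊤ := fun s => ENNReal.ofReal_ne_top
  have hkw : ∀ᵐ s : ℝ, ∫⁻ x, ‖K (s, x)‖ₑ ≤ w s := by
    filter_upwards [Measure.ae_ne volume (0 : ℝ)] with s hs using hslice s hs
  have hwL2 : ∫⁻ s, w s ^ 2 < ⊤ := by
    have h := (integrable_sq_time_weight.const_mul (M ^ 2)).lintegral_lt_top
    refine lt_of_eq_of_lt (lintegral_congr fun s => ?_) h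
    rw [hwdef, ← ENNReal.ofReal_pow (by positivity), mul_pow]
  refine ⟨lt_of_le_of_lt (lintegral_mono_ae ?_) hwL2, (∫⁻ s, w s ^ 2) ^ (1 / 2 : ℝ),
    ENNReal.rpow_ne_top_of_nonneg (by norm_num) hwL2.ne, fun g => ?_⟩
  · filter_upwards [hkw] with s hs
    exact pow_le_pow_left' hs 2
  · refine essSup_le_of_ae_le _ (.of_forall fun t => ?_)
    simp only [eLpNorm_eq_lintegral_rpow_enorm_toReal two_ne_zero ENNReal.ofNat_ne_top,
      ENNReal.toReal_ofNat, ENNReal.rpow_two]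
    rw [← ENNReal.mul_rpow_of_nonneg _ _ (by norm_num)]
    refine ENNReal.rpow_le_rpow (le_trans (lintegral_mono fun x => ?_)
      (lintegral_sq_convolution_slice_le (k := fun p => ‖K p‖ₑ) (f := fun p => ‖g p‖ₑ)
        hK.enorm g.continuous.measurable.enorm hw hw0 hwt hkw t)) (by norm_num)
    refine pow_le_pow_left' ((enorm_integral_le_lintegral_enorm _).trans_eq ?_) 2
    simp only [enorm_mul]
end

section
/- Let n ≥ 3. Every measurable function K : ℝ × ℝ^n → ℂ satisfying the pointwise bounds |K(t,x)| ≤ |x|^{-n-1/2} (1 + t²|x|^{-4})^{-3/8} whenever 0 < |t| ≤ 1, and |K(t,x)| ≤ e^{-|t|} |x|^{-n+1} ⟨x⟩^{-3/2} whenever |t| > 1, belongs to L²_t L¹_x: that is, ∫_ℝ ( ∫_{ℝ^n} |K(t,x)| dx )² dt < ∞. Consequently convolution with such a kernel K maps L²(ℝ×ℝ^n) boundedly into L^∞_t L²_x. -/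
open MeasureTheory ENNReal SchwartzMap

theorem lintegral_mul_sq_le {α : Type*} [MeasurableSpace α] {μ : Measure α} {u v : α → ℝ≥0∞}
    (hu : AEMeasurable u μ) (hv : AEMeasurable v μ) :
    (∫⁻ a, u a * v a ∂μ) ^ 2 ≤ (∫⁻ a, u a ^ 2 ∂μ) * ∫⁻ a, v a ^ 2 ∂μ := by
  have h := ENNReal.lintegral_mul_le_Lp_mul_Lq μ Real.HolderConjugate.two_two hu hv
  simp only [Pi.mul_apply, ENNReal.rpow_two] at h
  calc _ ≤ _ := pow_le_pow_left' h 2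
    _ = _ := by
      rw [mul_pow, ← ENNReal.rpow_two, ← ENNReal.rpow_two, ← ENNReal.rpow_mul,
        ← ENNReal.rpow_mul]
      norm_num

theorem lintegral_mul_sq_le_weight {α : Type*} [MeasurableSpace α] {μ : Measure α}
    {k g A : α → ℝ≥0∞} (hk : AEMeasurable k μ) (hg : AEMeasurable g μ) (hA : AEMeasurable A μ)
    (hA0 : ∀ᵐ a ∂μ, A a ≠ 0) (hAt : ∀ᵐ a ∂μ, A a ≠ ⊤) :
    (∫⁻ a, k a * g a ∂μ) ^ 2 ≤ (∫⁻ a, k a * A a ∂μ) * ∫⁻ a, k a * ((A a)⁻¹ * g a ^ 2) ∂μ := by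
  have h := lintegral_mul_sq_le (μ := μ) (u := fun a => (k a * A a) ^ (1 / 2 : ℝ))
    (v := fun a => (k a * (A a)⁻¹) ^ (1 / 2 : ℝ) * g a)
    ((hk.mul hA).pow_const _) (((hk.mul hA.inv).pow_const _).mul hg)
  have hsq (z : ℝ≥0∞) : (z ^ (1 / 2 : ℝ)) ^ 2 = z := by
    rw [← ENNReal.rpow_two, ← ENNReal.rpow_mul]; norm_num
  simp only [mul_pow, hsq] at h
  convert h using 2
  · refine lintegral_congr_ae ?_
    filter_upwards [hA0, hAt] with a h0 ht
    rw [← mul_assoc, ← ENNReal.mul_rpow_of_nonneg _ _ (by norm_num), mul_mul_mul_comm,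
      ENNReal.mul_inv_cancel h0 ht, mul_one, ← sq, ← ENNReal.rpow_two, ← ENNReal.rpow_mul]
    norm_num
  · simp only [mul_assoc]

theorem lintegral_conv_sq_le {E : Type*} [AddGroup E] [MeasurableSpace E] [MeasurableAdd₂ E]
    [MeasurableNeg E] {μ : Measure E} [SFinite μ] [μ.IsAddLeftInvariant]
    [μ.IsAddRightInvariant] [μ.IsNegInvariant]
    {k g : ℝ × E → ℝ≥0∞} {A : ℝ → ℝ≥0∞} (hk : Measurable k) (hg : Measurable g)
    (hA : Measurable A) (hA0 : ∀ᵐ s, A s ≠ 0) (hAt : ∀ᵐ s, A s ≠ ⊤)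
    (hkA : ∀ᵐ s, ∫⁻ x, k (s, x) ∂μ ≤ A s) (t : ℝ) :
    ∫⁻ x, (∫⁻ p, k (t - p.1, x - p.2) * g p ∂(volume.prod μ)) ^ 2 ∂μ ≤
      (∫⁻ s, A s ^ 2) * ∫⁻ p, g p ^ 2 ∂(volume.prod μ) := by
  have hq : Measure.QuasiMeasurePreserving (fun s : ℝ => t - s) volume volume :=
    (Measure.measurePreserving_sub_left volume t).quasiMeasurePreserving
  have hq1 : Measure.QuasiMeasurePreserving (fun p : ℝ × E => t - p.1) (volume.prod μ) volume :=
    hq.comp Measure.quasiMeasurePreserving_fst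
  have hweight (x : E) : ∫⁻ p, k (t - p.1, x - p.2) * A (t - p.1) ∂(volume.prod μ)
      ≤ ∫⁻ s, A s ^ 2 := by
    rw [lintegral_prod _ (by fun_prop)]
    simp only
    rw [← lintegral_sub_left_eq_self (fun s => A s ^ 2) t]
    refine lintegral_mono_ae ?_
    filter_upwards [hq.ae hkA] with s hs
    rw [lintegral_mul_const _ (by fun_prop), lintegral_sub_left_eq_self (fun y => k (t - s, y)) x,
      sq]
    gcongr
  calc
    _ ≤ ∫⁻ x, (∫⁻ s, A s ^ 2) *
        ∫⁻ p, k (t - p.1, x - p.2) * ((A (t - p.1))⁻¹ * g p ^ 2) ∂(volume.prod μ) ∂μ := by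
      refine lintegral_mono fun x => ?_
      refine (lintegral_mul_sq_le_weight (A := fun p : ℝ × E => A (t - p.1)) (by fun_prop)
        (by fun_prop) (by fun_prop) (hq1.ae hA0) (hq1.ae hAt)).trans ?_
      gcongr
      exact hweight x
    _ = (∫⁻ s, A s ^ 2) * ∫⁻ p, ∫⁻ x, k (t - p.1, x - p.2) * ((A (t - p.1))⁻¹ * g p ^ 2) ∂μ
        ∂(volume.prod μ) := by
      rw [lintegral_const_mul _ (by fun_prop), lintegral_lintegral_swap (by fun_prop)]
    _ ≤ _ := by
      refine mul_le_mul_right (lintegral_mono_ae ?_) _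
      filter_upwards [hq1.ae hkA, hq1.ae hA0, hq1.ae hAt] with p hp h0 ht
      rw [lintegral_mul_const _ (by fun_prop),
        lintegral_sub_right_eq_self (fun y => k (t - p.1, y)) p.2, ← mul_assoc]
      calc _ ≤ A (t - p.1) * (A (t - p.1))⁻¹ * g p ^ 2 := by gcongr
        _ = _ := by rw [ENNReal.mul_inv_cancel h0 ht, one_mul]

/-- The radial profile `min (δ ^ (-3/2)) (r ^ (-3/2))`, written piecewise. -/
noncomputable def truncatedPower (δ r : ℝ) : ℝ :=
  if r ≤ δ then δ ^ (-(3 : ℝ) / 2) else r ^ (-(3 : ℝ) / 2)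

theorem truncatedPower_nonneg {δ r : ℝ} (hδ : 0 < δ) : 0 ≤ truncatedPower δ r := by
  unfold truncatedPower
  split_ifs with h
  · positivity
  · have : 0 < r := hδ.trans (not_le.1 h)
    positivity

theorem integrableOn_truncatedPower {δ : ℝ} (hδ : 0 < δ) :
    IntegrableOn (truncatedPower δ) (Set.Ioi 0) ∧
      ∫ r in Set.Ioi 0, truncatedPower δ r = 3 * δ ^ (-(1 : ℝ) / 2) := by
  have h1 : Set.EqOn (truncatedPower δ) (fun _ => δ ^ (-(3 : ℝ) / 2)) (Set.Ioc 0 δ) :=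
    fun r hr => if_pos hr.2
  have h2 : Set.EqOn (truncatedPower δ) (fun r => r ^ (-(3 : ℝ) / 2)) (Set.Ioi δ) :=
    fun r hr => if_neg (not_le.2 hr)
  have i1 : IntegrableOn (truncatedPower δ) (Set.Ioc 0 δ) :=
    (integrableOn_congr_fun h1 measurableSet_Ioc).2 (by simp)
  have i2 : IntegrableOn (truncatedPower δ) (Set.Ioi δ) :=
    (integrableOn_congr_fun h2 measurableSet_Ioi).2
      (integrableOn_Ioi_rpow_of_lt (by norm_num) hδ)
  rw [← Set.Ioc_union_Ioi_eq_Ioi hδ.le]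
  refine ⟨i1.union i2, ?_⟩
  rw [setIntegral_union (Set.Ioc_disjoint_Ioi le_rfl) measurableSet_Ioi i1 i2,
    setIntegral_congr_fun measurableSet_Ioc h1, setIntegral_congr_fun measurableSet_Ioi h2,
    integral_Ioi_rpow_of_lt (by norm_num) hδ]
  have : δ ^ (-(1 : ℝ) / 2) = δ * δ ^ (-(3 : ℝ) / 2) := by
    nth_rewrite 2 [← Real.rpow_one δ]
    rw [← Real.rpow_add hδ]; norm_num
  have e : (-(3 : ℝ) / 2 + 1) = -1 / 2 := by norm_num
  simp [hδ.le, e]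
  rw [this]; ring

theorem lintegral_radial_truncatedPower {E : Type*} [NormedAddCommGroup E] [NormedSpace ℝ E]
    [Nontrivial E] [FiniteDimensional ℝ E] [MeasurableSpace E] [BorelSpace E] (μ : Measure E)
    [μ.IsAddHaarMeasure] {δ : ℝ} (hδ : 0 < δ) :
    ∫⁻ x, ENNReal.ofReal (‖x‖ ^ (-(Module.finrank ℝ E : ℝ) + 1) * truncatedPower δ ‖x‖) ∂μ =
      ENNReal.ofReal (3 * (Module.finrank ℝ E * μ.real (Metric.ball 0 1)) *
        δ ^ (-(1 : ℝ) / 2)) := by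
  have h : Set.EqOn (fun r : ℝ => r ^ (Module.finrank ℝ E - 1) •
      (r ^ (-(Module.finrank ℝ E : ℝ) + 1) * truncatedPower δ r)) (truncatedPower δ)
      (Set.Ioi 0) := by
    intro r hr
    have hr : 0 < r := hr
    have hd : 1 ≤ Module.finrank ℝ E := Module.finrank_pos
    simp only [smul_eq_mul]
    rw [← mul_assoc, ← Real.rpow_natCast, ← Real.rpow_add hr]
    simp [Nat.cast_sub hd]
  rw [← ofReal_integral_eq_lintegral_ofReal, integral_fun_norm_addHaar μ
    (fun r : ℝ => r ^ (-(Module.finrank ℝ E : ℝ) + 1) * truncatedPower δ r),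
    setIntegral_congr_fun measurableSet_Ioi h, (integrableOn_truncatedPower hδ).2]
  · simp only [nsmul_eq_mul, smul_eq_mul]
    congr 1; ring
  · rw [integrable_fun_norm_addHaar μ
      (f := fun r : ℝ => r ^ (-(Module.finrank ℝ E : ℝ) + 1) * truncatedPower δ r),
      integrableOn_congr_fun h measurableSet_Ioi]
    exact (integrableOn_truncatedPower hδ).1
  · exact .of_forall fun x => mul_nonneg (by positivity) (truncatedPower_nonneg hδ)

theorem integrable_abs_rpow_mul_exp_neg {s : ℝ} (hs : 0 < s) :
    Integrable fun t : ℝ => |t| ^ (s - 1) * Real.exp (-|t|) := by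
  have := (integrable_fun_norm_addHaar (volume : Measure ℝ)
    (f := fun r : ℝ => r ^ (s - 1) * Real.exp (-r))).2
    ((integrableOn_congr_fun (fun r _ => by simp [mul_comm]) measurableSet_Ioi).2
      (Real.GammaIntegral_convergent hs))
  simpa using this

theorem rpow_mul_bound_le_truncatedPower {d t r : ℝ} (hr : 0 < r) (ht : 0 < |t|) :
    r ^ (-d - 1 / 2) * (1 + t ^ 2 * r ^ (-(4 : ℝ))) ^ (-(3 : ℝ) / 8) ≤
      r ^ (-d + 1) * truncatedPower (|t| ^ (1 / 2 : ℝ)) r := by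
  have e : r ^ (-d - 1 / 2) = r ^ (-d + 1) * r ^ (-(3 : ℝ) / 2) := by
    rw [← Real.rpow_add hr]; congr 1; ring
  rw [e, mul_assoc]
  gcongr
  unfold truncatedPower
  split_ifs
  · calc
      _ ≤ r ^ (-(3 : ℝ) / 2) * (t ^ 2 * r ^ (-(4 : ℝ))) ^ (-(3 : ℝ) / 8) := by
        gcongr ?_ * ?_
        refine Real.rpow_le_rpow_of_nonpos ?_ (by linarith) (by norm_num)
        rw [← sq_abs]; positivity
      _ = _ := by
        rw [← sq_abs, Real.mul_rpow (by positivity) (by positivity), ← Real.rpow_natCast,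
          ← Real.rpow_mul hr.le, ← Real.rpow_mul ht.le, ← Real.rpow_mul ht.le, mul_left_comm,
          ← Real.rpow_add hr]
        norm_num
  · refine mul_le_of_le_one_right (by positivity) ?_
    exact Real.rpow_le_one_of_one_le_of_nonpos (le_add_of_nonneg_right (by positivity))
      (by norm_num)

theorem rpow_one_add_sq_le_truncatedPower {r : ℝ} (hr : 0 < r) :
    (1 + r ^ 2) ^ (-(3 : ℝ) / 4) ≤ truncatedPower 1 r := by
  unfold truncatedPower
  split_ifs
  · rw [Real.one_rpow]
    exact Real.rpow_le_one_of_one_le_of_nonpos (by nlinarith) (by norm_num)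
  · calc (1 + r ^ 2) ^ (-(3 : ℝ) / 4) ≤ (r ^ 2) ^ (-(3 : ℝ) / 4) :=
          Real.rpow_le_rpow_of_nonpos (by positivity) (by linarith) (by norm_num)
      _ = _ := by
        rw [← Real.rpow_natCast, ← Real.rpow_mul hr.le]; norm_num

theorem lintegral_slice_le {n : ℕ} (hn : n ≠ 0)
    {K : ℝ × EuclideanSpace ℝ (Fin n) → ℂ}
    (h1 : ∀ (t : ℝ) (x : EuclideanSpace ℝ (Fin n)), x ≠ 0 → 0 < |t| → |t| ≤ 1 →
      ‖K (t, x)‖ ≤ ‖x‖ ^ (-(n : ℝ) - 1 / 2) *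
        (1 + t ^ 2 * ‖x‖ ^ (-(4 : ℝ))) ^ (-(3 : ℝ) / 8))
    (h2 : ∀ (t : ℝ) (x : EuclideanSpace ℝ (Fin n)), x ≠ 0 → 1 < |t| →
      ‖K (t, x)‖ ≤ Real.exp (-|t|) * ‖x‖ ^ (-(n : ℝ) + 1) *
        (1 + ‖x‖ ^ 2) ^ (-(3 : ℝ) / 4)) :
    ∃ c : ℝ, 0 < c ∧ ∀ t : ℝ, t ≠ 0 → ∫⁻ x, ‖K (t, x)‖ₑ ≤
      ENNReal.ofReal (c * (|t| ^ (-(1 : ℝ) / 4) * Real.exp (-|t| / 2))) := by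
  have : NeZero n := ⟨hn⟩
  have hvol : 0 < (volume : Measure (EuclideanSpace ℝ (Fin n))).real (Metric.ball 0 1) :=
    ENNReal.toReal_pos (Metric.measure_ball_pos _ _ one_pos).ne' measure_ball_lt_top.ne
  set c : ℝ := 3 * (n * (volume : Measure (EuclideanSpace ℝ (Fin n))).real (Metric.ball 0 1))
    with hc
  have hc0 : 0 < c := by positivity
  have hrad {δ : ℝ} (hδ : 0 < δ) := lintegral_radial_truncatedPower
    (volume : Measure (EuclideanSpace ℝ (Fin n))) hδ
  simp only [finrank_euclideanSpace_fin, ← hc] at hrad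
  clear_value c
  have hne : ∀ᵐ x : EuclideanSpace ℝ (Fin n), x ≠ 0 := by simp [ae_iff]
  refine ⟨c * Real.exp 1, by positivity, fun t ht => ?_⟩
  have ht0 : 0 < |t| := abs_pos.2 ht
  rcases le_or_gt |t| 1 with ht1 | ht1
  · calc
      _ ≤ ∫⁻ x : EuclideanSpace ℝ (Fin n), ENNReal.ofReal
          (‖x‖ ^ (-(n : ℝ) + 1) * truncatedPower (|t| ^ (1 / 2 : ℝ)) ‖x‖) := by
        refine lintegral_mono_ae ?_
        filter_upwards [hne] with x hx
        rw [← ofReal_norm]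
        exact ENNReal.ofReal_le_ofReal ((h1 t x hx ht0 ht1).trans
          (rpow_mul_bound_le_truncatedPower (norm_pos_iff.2 hx) ht0))
      _ ≤ _ := by
        rw [hrad (by positivity), ← Real.rpow_mul ht0.le, mul_assoc c, mul_left_comm (Real.exp 1),
          ← Real.exp_add]
        refine ENNReal.ofReal_le_ofReal ?_
        norm_num
        gcongr
        refine le_mul_of_one_le_right (by positivity) (Real.one_le_exp (by linarith))
  · calc
      _ ≤ ∫⁻ x : EuclideanSpace ℝ (Fin n), ENNReal.ofReal (Real.exp (-|t|)) * ENNReal.ofReal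
          (‖x‖ ^ (-(n : ℝ) + 1) * truncatedPower 1 ‖x‖) := by
        refine lintegral_mono_ae ?_
        filter_upwards [hne] with x hx
        rw [← ofReal_norm, ← ENNReal.ofReal_mul (Real.exp_pos _).le, ← mul_assoc]
        refine ENNReal.ofReal_le_ofReal ((h2 t x hx ht1).trans ?_)
        gcongr
        exact rpow_one_add_sq_le_truncatedPower (norm_pos_iff.2 hx)
      _ ≤ _ := by
        rw [lintegral_const_mul' _ _ ENNReal.ofReal_ne_top, hrad one_pos,
          ← ENNReal.ofReal_mul (Real.exp_pos _).le]
        refine ENNReal.ofReal_le_ofReal ?_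
        rw [Real.one_rpow, mul_one, mul_comm, mul_assoc c]
        gcongr
        have h : Real.exp (-|t| / 4) ≤ |t| ^ (-(1 : ℝ) / 4) := by
          rw [Real.rpow_def_of_pos ht0]
          gcongr
          linarith [Real.log_le_sub_one_of_pos ht0]
        calc Real.exp (-|t|) ≤ Real.exp 1 * (Real.exp (-|t| / 4) * Real.exp (-|t| / 2)) := by
              rw [← Real.exp_add, ← Real.exp_add]
              gcongr
              linarith
          _ ≤ _ := by gcongr

theorem lintegral_weight_sq_lt_top {c : ℝ} (hc : 0 ≤ c) :
    ∫⁻ t : ℝ, ENNReal.ofReal (c * (|t| ^ (-(1 : ℝ) / 4) * Real.exp (-|t| / 2))) ^ 2 < ⊤ := by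
  have h := ((integrable_abs_rpow_mul_exp_neg (s := 1 / 2) (by norm_num)).const_mul
    (c ^ 2)).lintegral_lt_top
  refine lt_of_le_of_lt (lintegral_mono fun t => ?_) h
  rw [← ENNReal.ofReal_pow (by positivity), mul_pow, mul_pow,
    ← Real.rpow_mul_natCast (abs_nonneg t), ← Real.exp_nat_mul]
  refine le_of_eq ?_
  norm_num
  ring_nf

/-- Any kernel satisfying the size bounds of the commutator kernel `K₂`
(i.e. `|K(t,x)| ≤ |x|^{-n-1/2}⟨t|x|^{-2}⟩^{-3/4}` for `0 < |t| ≤ 1` and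
`|K(t,x)| ≤ e^{-|t|}|x|^{-n+1}⟨x⟩^{-3/2}` for `|t| > 1`) belongs to
`L²_t L¹_x`, and consequently convolution with it maps `L²(ℝ×ℝⁿ)` boundedly
into `L^∞_t L²_x`. -/
theorem commutator_kernel_K2_L2L1 (n : ℕ) (hn : 3 ≤ n)
    (K : ℝ × EuclideanSpace ℝ (Fin n) → ℂ) (hK : Measurable K)
    (h1 : ∀ (t : ℝ) (x : EuclideanSpace ℝ (Fin n)), x ≠ 0 → 0 < |t| → |t| ≤ 1 →
      ‖K (t, x)‖ ≤ ‖x‖ ^ (-(n : ℝ) - 1 / 2) *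
        (1 + t ^ 2 * ‖x‖ ^ (-(4 : ℝ))) ^ (-(3 : ℝ) / 8))
    (h2 : ∀ (t : ℝ) (x : EuclideanSpace ℝ (Fin n)), x ≠ 0 → 1 < |t| →
      ‖K (t, x)‖ ≤ Real.exp (-|t|) * ‖x‖ ^ (-(n : ℝ) + 1) *
        (1 + ‖x‖ ^ 2) ^ (-(3 : ℝ) / 4)) :
    (∫⁻ t : ℝ, (∫⁻ x : EuclideanSpace ℝ (Fin n), (‖K (t, x)‖₊ : ℝ≥0∞)) ^ 2) < ⊤ ∧
    ∃ C : ℝ≥0∞, C ≠ ⊤ ∧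
      ∀ g : 𝓢(ℝ × EuclideanSpace ℝ (Fin n), ℂ),
        essSup
            (fun t : ℝ => eLpNorm
              (fun x : EuclideanSpace ℝ (Fin n) =>
                ∫ p : ℝ × EuclideanSpace ℝ (Fin n), K (t - p.1, x - p.2) * g p)
              2 volume)
            volume
          ≤ C * eLpNorm (⇑g) 2 volume := by
  obtain ⟨c, hc, hslice⟩ := lintegral_slice_le (by lia) h1 h2
  set A : ℝ → ℝ≥0∞ := fun t =>
    ENNReal.ofReal (c * (|t| ^ (-(1 : ℝ) / 4) * Real.exp (-|t| / 2)))
  have hAint : ∫⁻ t, A t ^ 2 < ⊤ := lintegral_weight_sq_lt_top hc.le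
  have hne : ∀ᵐ t : ℝ, t ≠ 0 := by simp [ae_iff]
  have hKA : ∀ᵐ t, ∫⁻ x, ‖K (t, x)‖ₑ ≤ A t := hne.mono hslice
  refine ⟨(lintegral_mono_ae (hKA.mono fun t ht => pow_le_pow_left' ht 2)).trans_lt hAint,
    (∫⁻ t, A t ^ 2) ^ (1 / 2 : ℝ), (ENNReal.rpow_lt_top_of_nonneg (by norm_num) hAint.ne).ne,
    fun g => essSup_le_of_ae_le _ (.of_forall fun t => ?_)⟩
  simp only
  rw [eLpNorm_eq_lintegral_rpow_enorm_toReal two_ne_zero ofNat_ne_top,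
    eLpNorm_eq_lintegral_rpow_enorm_toReal two_ne_zero ofNat_ne_top]
  simp only [toReal_ofNat, ENNReal.rpow_two]
  rw [← ENNReal.mul_rpow_of_nonneg _ _ (by norm_num)]
  gcongr
  have hconv := lintegral_conv_sq_le (μ := (volume : Measure (EuclideanSpace ℝ (Fin n))))
    hK.enorm g.continuous.measurable.enorm (A := A) (by fun_prop)
    (hne.mono fun s hs => by
      have : 0 < |s| := abs_pos.2 hs
      exact (ENNReal.ofReal_pos.2 (by positivity)).ne')
    (.of_forall fun s => ENNReal.ofReal_ne_top) hKA t
  refine le_trans (lintegral_mono fun x => pow_le_pow_left' ?_ 2) hconv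
  refine (enorm_integral_le_lintegral_enorm _).trans_eq ?_
  simp only [enorm_mul]
  rfl
end
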